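/- arXiv:1512.04978 — 3 statements merged into one kernel-verified Lean document; each statement's English description precedes it below -/
import Mathlib

section
/- Let q be odd, n ≡ 2 (mod 4), and q ≡ 3 (mod 4). Let u ∈ SL_n(F_q) be a unipotent element all of whose Jordan block sizes are even. Then every h ∈ GL_n(F_q) with h u h⁻¹ = u⁻¹ has determinant a nonsquare in F_q^×; in particular u is not real in SL_n(F_q). -/
open Module in
theorem aux_det_one_add {F V : Type*} [Field F] [AddCommGroup V] [Module F V]
    [FiniteDimensional F V] (N : V →ₗ[F] V) (hN : IsNilpotent N) :
    LinearMap.det (1 + N) = 1 := by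
  have h1 : IsNilpotent (-N) := hN.neg
  have h2 := LinearMap.eval_charpoly (-N) (1 : F)
  rw [IsNilpotent.charpoly_eq_X_pow_finrank h1] at h2
  simpa using h2.symm

theorem aux_range_stable {F V : Type*} [Field F] [AddCommGroup V] [Module F V]
    (N h : V →ₗ[F] V) (hr : N * h * N + N * h + h * N = 0) :
    ∀ x ∈ LinearMap.range N, h x ∈ LinearMap.range N := by
  rintro _ ⟨x, rfl⟩
  refine ⟨-(h (N x)) - h x, ?_⟩
  have := LinearMap.congr_fun hr x
  simp only [LinearMap.add_apply, Module.End.mul_apply, LinearMap.zero_apply] at this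
  rw [map_sub, map_neg]
  rw [← sub_eq_zero, ← neg_eq_zero, ← this]; abel

theorem aux_ker_stable {F V : Type*} [Field F] [AddCommGroup V] [Module F V]
    (N h : V →ₗ[F] V) (hr : N * h * N + N * h + h * N = 0) :
    ∀ x ∈ LinearMap.ker N, h x ∈ LinearMap.ker N := by
  intro x hx
  have := LinearMap.congr_fun hr x
  simp only [LinearMap.add_apply, Module.End.mul_apply, LinearMap.zero_apply] at this
  rw [LinearMap.mem_ker] at hx ⊢
  simpa [hx] using this

/-- restriction of `N` to its range -/
def auxN {F V : Type*} [Field F] [AddCommGroup V] [Module F V]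
    (N : V →ₗ[F] V) : LinearMap.range N →ₗ[F] LinearMap.range N :=
  N.restrict (fun x _ => ⟨x, rfl⟩)

theorem auxN_pow {F V : Type*} [Field F] [AddCommGroup V] [Module F V]
    (N : V →ₗ[F] V) (k : ℕ) (x : LinearMap.range N) :
    (((auxN N) ^ k) x : V) = (N ^ k) x := by
  induction k with
  | zero => simp
  | succ k ih =>
    rw [pow_succ', pow_succ', Module.End.mul_apply, Module.End.mul_apply, ← ih]; rfl

theorem auxN_nil {F V : Type*} [Field F] [AddCommGroup V] [Module F V]
    (N : V →ₗ[F] V) (hN : IsNilpotent N) : IsNilpotent (auxN N) := by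
  obtain ⟨k, hk⟩ := hN
  refine ⟨k, ?_⟩
  ext x
  rw [auxN_pow, hk]; rfl

theorem auxN_finrank {F V : Type*} [Field F] [AddCommGroup V] [Module F V]
    (N : V →ₗ[F] V) (k : ℕ) :
    Module.finrank F (LinearMap.range ((auxN N) ^ k)) =
      Module.finrank F (LinearMap.range (N ^ (k + 1))) := by
  have : (LinearMap.range ((auxN N) ^ k)).map (LinearMap.range N).subtype
      = LinearMap.range (N ^ (k + 1)) := by
    ext y
    constructor
    · rintro ⟨_, ⟨⟨_, ⟨x, rfl⟩⟩, rfl⟩, rfl⟩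
      refine ⟨x, ?_⟩
      rw [Submodule.subtype_apply, auxN_pow, pow_succ]; rfl
    · rintro ⟨x, rfl⟩
      refine ⟨_, ⟨⟨N x, ⟨x, rfl⟩⟩, rfl⟩, ?_⟩
      rw [Submodule.subtype_apply, auxN_pow, pow_succ]; rfl
  rw [← this]
  exact (Submodule.finrank_map_subtype_eq _ _).symm

theorem aux_step {F V : Type*} [Field F] [AddCommGroup V] [Module F V]
    [FiniteDimensional F V] (N h : V →ₗ[F] V) (hN : IsNilpotent N)
    (hr : N * h * N + N * h + h * N = 0) :
    LinearMap.det h = LinearMap.det (h.restrict (aux_ker_stable N h hr)) *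
      ((-1) ^ Module.finrank F (LinearMap.range N) *
        LinearMap.det (h.restrict (aux_range_stable N h hr))) := by
  rw [LinearMap.det_eq_det_mul_det (LinearMap.ker N) h (aux_ker_stable N h hr)]
  congr 1
  rw [← LinearMap.det_conj _ N.quotKerEquivRange]
  have : (N.quotKerEquivRange.toLinearMap ∘ₗ
      ((LinearMap.ker N).mapQ (LinearMap.ker N) h (aux_ker_stable N h hr)) ∘ₗ
      N.quotKerEquivRange.symm.toLinearMap) =
      (-1 : F) • ((1 + auxN N) * (h.restrict (aux_range_stable N h hr))) := by
    ext ⟨_, ⟨x, rfl⟩⟩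
    have h1 : N.quotKerEquivRange.symm ⟨N x, ⟨x, rfl⟩⟩ = Submodule.Quotient.mk x := by
      rw [LinearEquiv.symm_apply_eq]; rfl
    have := LinearMap.congr_fun hr x
    simp only [LinearMap.add_apply, Module.End.mul_apply, LinearMap.zero_apply] at this
    simp only [LinearMap.comp_apply, LinearEquiv.coe_coe, h1]
    change N (h x) = (-1 : F) • (h (N x) + N (h (N x)))
    rw [neg_one_smul, ← sub_eq_zero, ← this]; abel
  rw [this, LinearMap.det_smul, map_mul, aux_det_one_add _ (auxN_nil N hN), one_mul]

theorem aux_rel {F V : Type*} [Field F] [AddCommGroup V] [Module F V]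
    (N h : V →ₗ[F] V) (hr : N * h * N + N * h + h * N = 0) :
    auxN N * (h.restrict (aux_range_stable N h hr)) * auxN N
      + auxN N * (h.restrict (aux_range_stable N h hr))
      + (h.restrict (aux_range_stable N h hr)) * auxN N = 0 := by
  ext x
  exact LinearMap.congr_fun hr (x : V)

theorem aux_ker_det {F V : Type*} [Field F] [AddCommGroup V] [Module F V]
    [FiniteDimensional F V] (N h : V →ₗ[F] V)
    (hr : N * h * N + N * h + h * N = 0)
    (hd : Module.finrank F V + Module.finrank F (LinearMap.range (N ^ 2)) =
      2 * Module.finrank F (LinearMap.range N)) :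
    LinearMap.det ((h.restrict (aux_range_stable N h hr)).restrict
      (aux_ker_stable (auxN N) _ (aux_rel N h hr))) =
    LinearMap.det (h.restrict (aux_ker_stable N h hr)) := by
  have a1 := LinearMap.finrank_range_add_finrank_ker N
  have a2 := LinearMap.finrank_range_add_finrank_ker (auxN N)
  have a3 := auxN_finrank N 1
  rw [pow_one, one_add_one_eq_two] at a3
  let f : LinearMap.ker (auxN N) →ₗ[F] LinearMap.ker N :=
    ((LinearMap.range N).subtype ∘ₗ (LinearMap.ker (auxN N)).subtype).codRestrict _
      (fun x => congrArg Subtype.val (LinearMap.mem_ker.1 x.2))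
  have hf : Function.Injective f := by
    intro x y hxy
    exact Subtype.ext (Subtype.ext (congrArg (fun z : LinearMap.ker N => (z : V)) hxy))
  let e := LinearEquiv.ofInjectiveOfFinrankEq f hf (by omega)
  rw [← LinearMap.det_conj _ e]
  congr 1
  ext x
  obtain ⟨y, rfl⟩ := e.surjective x
  simp only [LinearMap.comp_apply, LinearEquiv.coe_coe, e.symm_apply_apply]
  rfl

universe u

theorem aux_main {F : Type*} [Field F] (m : ℕ) : ∀ {V : Type u} [AddCommGroup V] [Module F V]
    [FiniteDimensional F V] (N h : V →ₗ[F] V), Module.finrank F V ≤ m → IsNilpotent N →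
    N * h * N + N * h + h * N = 0 →
    (∀ k : ℕ, Module.finrank F (LinearMap.range (N ^ (2 * k))) +
      Module.finrank F (LinearMap.range (N ^ (2 * k + 2))) =
      2 * Module.finrank F (LinearMap.range (N ^ (2 * k + 1)))) →
    ∃ (s : F) (d : ℕ), Module.finrank F V = 2 * d ∧ LinearMap.det h = (-1) ^ d * s ^ 2 := by
  induction m with
  | zero =>
    intro V _ _ _ N h hm _ _ _
    refine ⟨1, 0, by omega, ?_⟩
    rw [LinearMap.det_eq_one_of_finrank_eq_zero (by omega)]; simp
  | succ m ih =>
    intro V _ _ _ N h hm hN hr hk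
    rcases Nat.eq_zero_or_pos (Module.finrank F V) with h0 | hpos
    · exact ih N h (by omega) hN hr hk
    have hd := hk 0
    rw [mul_zero, zero_add, zero_add, pow_zero, pow_one, Module.End.one_eq_id, LinearMap.range_id, finrank_top] at hd
    have b2 := auxN_finrank N 1
    rw [pow_one, one_add_one_eq_two] at b2
    have hlt : Module.finrank F (LinearMap.range N) < Module.finrank F V := by
      apply Submodule.finrank_lt
      intro htop
      obtain ⟨k, hk⟩ := hN
      have hs : Function.Surjective (N ^ k) := by
        rw [Module.End.coe_pow]
        exact (LinearMap.range_eq_top.1 htop).iterate k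
      have : Nontrivial V := Module.finrank_pos_iff.1 hpos
      obtain ⟨v, hv⟩ := exists_ne (0 : V)
      obtain ⟨w, hw⟩ := hs v
      rw [hk] at hw
      exact hv hw.symm
    have r1 := aux_rel N h hr
    have n1 := auxN_nil N hN
    have r2 := aux_rel _ _ r1
    have n2 := auxN_nil _ n1
    obtain ⟨s, d, hd1, hd2⟩ := ih _ _ (by omega) n2 r2 (by
      intro k
      simp only [auxN_finrank]
      exact hk (k + 1))
    have s1 := aux_step N h hN hr
    have s2 := aux_step _ _ n1 r1
    rw [aux_ker_det N h hr hd, hd2] at s2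
    obtain ⟨c, hc⟩ : ∃ c, Module.finrank F V = Module.finrank F (LinearMap.range N) + c :=
      ⟨_, (Nat.add_sub_of_le hlt.le).symm⟩
    refine ⟨s * LinearMap.det (h.restrict (aux_ker_stable N h hr)), d + c, by omega, ?_⟩
    rw [s1, s2, show Module.finrank F (LinearMap.range N) = 2 * d + c by omega, hd1]
    simp only [pow_add, pow_mul]
    rw [neg_one_sq, one_pow]
    ring


/-- For `q ≡ 3 (mod 4)`, `n ≡ 2 (mod 4)`, and a unipotent `u ∈ SL_n(F_q)` all of
whose Jordan block sizes are even (encoded by ranks of powers of `u − 1`), every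
element of `GL_n(F_q)` inverting `u` has nonsquare determinant; in particular `u`
is not real in `SL_n(F_q)`. -/
theorem stmt_13 (p e q n : ℕ) (hp : p.Prime) (he : 0 < e) (hq : q = p ^ e)
    (h3 : q % 4 = 3) (hn : n % 4 = 2)
    (F : Type*) [Field F] [Fintype F] (hcard : Fintype.card F = q)
    (u : Matrix.GeneralLinearGroup (Fin n) F)
    (hdet : Matrix.det (↑u : Matrix (Fin n) (Fin n) F) = 1)
    (huni : ((↑u : Matrix (Fin n) (Fin n) F) - 1) ^ n = 0)
    (heven : ∀ k : ℕ, Odd k →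
      (((↑u : Matrix (Fin n) (Fin n) F) - 1) ^ (k - 1)).rank +
          (((↑u : Matrix (Fin n) (Fin n) F) - 1) ^ (k + 1)).rank =
        2 * (((↑u : Matrix (Fin n) (Fin n) F) - 1) ^ k).rank) :
    (∀ h : Matrix.GeneralLinearGroup (Fin n) F, h * u * h⁻¹ = u⁻¹ →
        ¬ IsSquare (Matrix.det (↑h : Matrix (Fin n) (Fin n) F))) ∧
      ¬ ∃ h : Matrix.GeneralLinearGroup (Fin n) F,
        Matrix.det (↑h : Matrix (Fin n) (Fin n) F) = 1 ∧ h * u * h⁻¹ = u⁻¹ := by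

  have hf : ∀ h : Matrix.GeneralLinearGroup (Fin n) F, h * u * h⁻¹ = u⁻¹ →
        ¬ IsSquare (Matrix.det (↑h : Matrix (Fin n) (Fin n) F)) := by
    intro h hh hsq
    have h1 : u * h * u = h := by
      have : h * u = u⁻¹ * h := by rw [← hh]; group
      rw [mul_assoc, this]; group
    have h2 : (u : Matrix (Fin n) (Fin n) F) * h * u = h := by
      exact_mod_cast congrArg Units.val h1
    generalize hM : (u : Matrix (Fin n) (Fin n) F) - 1 = M at huni heven
    have hu : (u : Matrix (Fin n) (Fin n) F) = 1 + M := by rw [← hM]; abel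
    generalize hH : (h : Matrix (Fin n) (Fin n) F) = H at hsq h2
    rw [hu] at h2
    have h3' : M * H * M + M * H + H * M = 0 := by
      have : (1 + M) * H * (1 + M) - H = 0 := sub_eq_zero.2 h2
      rw [← this]; noncomm_ring
    have hpow : ∀ k, (Matrix.toLin' M) ^ k = Matrix.toLin' (M ^ k) := fun k =>
      (map_pow Matrix.toLinAlgEquiv' M k).symm
    obtain ⟨s, d, hd, hdet'⟩ := aux_main n (Matrix.toLin' M) (Matrix.toLin' H) (by simp)
      ⟨n, by rw [hpow, huni, map_zero]⟩
      (by
        have := congrArg Matrix.toLin' h3'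
        rw [map_add, map_add, Matrix.toLin'_mul, Matrix.toLin'_mul, Matrix.toLin'_mul, map_zero] at this
        exact this)
      (by
        intro k
        have := heven (2 * k + 1) ⟨k, rfl⟩
        rw [hpow, hpow, hpow]
        exact this)
    rw [LinearMap.det_toLin'] at hdet'
    have hdn : n = 2 * d := by simpa using hd
    have hodd : Odd d := by rw [Nat.odd_iff]; omega
    rw [hodd.neg_one_pow] at hdet'
    have hne : H.det ≠ 0 := by
      rw [← hH]
      exact (Matrix.isUnits_det_units h).ne_zero
    have hs : s ≠ 0 := by
      rintro rfl
      exact hne (by rw [hdet']; simp)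
    obtain ⟨t, ht⟩ := hsq
    have : IsSquare (-1 : F) := ⟨t / s, by
      field_simp
      rw [pow_two t, ← ht, hdet']; ring⟩
    rw [FiniteField.isSquare_neg_one_iff, hcard] at this
    exact this h3
  refine ⟨hf, ?_⟩
  rintro ⟨h, h1, h2⟩
  exact hf h h2 (h1 ▸ IsSquare.one)
end

section
/- Let q be an odd prime power and let g be an element of a finite orthogonal group O(V) over F_q with dim V = n, such that no elementary divisor of g is of the form (t−1)^k or (t+1)^k with k odd. Then n is even and g is inverted by an involution h ∈ O(V) with det(h) = (−1)^{n/2}. -/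
open Polynomial

section Wonenburger

variable {F V : Type*} [Field F] [AddCommGroup V] [Module F V]

/-- cyclic submodule -/
noncomputable def wCyc (Y : Module.End F V) (w : V) : Submodule F V :=
  LinearMap.range ((LinearMap.applyₗ w : (V →ₗ[F] V) →ₗ[F] V) ∘ₗ (aeval Y : F[X] →ₐ[F] Module.End F V).toLinearMap)

lemma mem_wCyc {Y : Module.End F V} {w x : V} : x ∈ wCyc Y w ↔ ∃ p : F[X], aeval Y p w = x := by
  simp [wCyc]

lemma wCyc_self (Y : Module.End F V) (w : V) : w ∈ wCyc Y w := mem_wCyc.2 ⟨1, by simp⟩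

lemma wCyc_map (Y : Module.End F V) (w : V) (q : F[X]) {x : V} (hx : x ∈ wCyc Y w) :
    aeval Y q x ∈ wCyc Y w := by
  obtain ⟨p, rfl⟩ := mem_wCyc.1 hx
  exact mem_wCyc.2 ⟨q * p, by simp⟩

lemma w_compl [FiniteDimensional F V] (B : LinearMap.BilinForm F V) (hs : ∀ x y, B x y = B y x)
    (U : Submodule F V) (hU : ∀ x ∈ U, (∀ y ∈ U, B x y = 0) → x = 0) :
    IsCompl U (B.orthogonal U) := by
  have hr : B.IsRefl := fun x y h => by rw [hs]; exact h
  rw [LinearMap.BilinForm.isCompl_orthogonal_iff_disjoint hr, Submodule.disjoint_def]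
  intro x hx hx'
  refine hU x hx fun y hy => ?_
  rw [hs]; exact hx' y hy

lemma w_orth {B : LinearMap.BilinForm F V} {U : Submodule F V} {x y : V} (hx : x ∈ U)
    (hy : y ∈ B.orthogonal U) : B x y = 0 := hy x hx

lemma w_nondeg_orth [FiniteDimensional F V] (B : LinearMap.BilinForm F V) (hs : ∀ x y, B x y = B y x)
    (hB : ∀ x, (∀ y, B x y = 0) → x = 0)
    (U : Submodule F V) (hc : IsCompl U (B.orthogonal U)) :
    ∀ x ∈ B.orthogonal U, (∀ y ∈ B.orthogonal U, B x y = 0) → x = 0 := by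
  intro x hx h
  refine hB x fun y => ?_
  have : y ∈ U ⊔ B.orthogonal U := by rw [hc.sup_eq_top]; trivial
  obtain ⟨a, ha, b, hb, rfl⟩ := Submodule.mem_sup.1 this
  rw [map_add, h b hb, hs, w_orth ha hx, add_zero]

lemma w_selfadj (B : LinearMap.BilinForm F V) (Y : Module.End F V)
    (hY : ∀ x y, B (Y x) y = B x (Y y)) (p : F[X]) :
    ∀ x y, B (aeval Y p x) y = B x (aeval Y p y) := by
  induction p using Polynomial.induction_on' with
  | add p q hp hq => intro x y; simp [hp, hq]
  | monomial n a =>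
    have : ∀ n : ℕ, ∀ x y, B ((Y ^ n) x) y = B x ((Y ^ n) y) := by
      intro n
      induction n with
      | zero => simp
      | succ n ih => intro x y; rw [pow_succ, Module.End.mul_apply, ih, hY, ← Module.End.mul_apply, ← pow_succ', pow_succ]
    intro x y
    simp [aeval_monomial, this, Module.algebraMap_end_apply]

lemma w_polar (h2 : (2 : F) ≠ 0) (B : LinearMap.BilinForm F V) (hs : ∀ x y, B x y = B y x)
    (hB : ∀ x, (∀ y, B x y = 0) → x = 0) (E : Module.End F V)
    (hE : ∀ x y, B (E x) y = B x (E y)) (hne : E ≠ 0) : ∃ v, B (E v) v ≠ 0 := by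
  by_contra! h
  apply hne
  ext x
  refine hB _ fun y => ?_
  have h1 := h (x + y)
  simp only [map_add, LinearMap.add_apply, h x, h y] at h1
  rw [hE y x, hs y (E x)] at h1
  have : 2 * B (E x) y = 0 := by linear_combination h1
  exact (mul_eq_zero.1 this).resolve_left h2

def WPair (B : LinearMap.BilinForm F V) (D : Module.End F V) (P Q : Submodule F V) : Prop :=
  (∀ x ∈ P, ∀ y ∈ Q, B x y = 0) ∧ (∀ x ∈ P, D x ∈ Q) ∧ (∀ x ∈ Q, D x ∈ P)

lemma w_comm (D : Module.End F V) (p : F[X]) (w : V) :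
    D (aeval (D * D) p w) = aeval (D * D) p (D w) := by
  induction p using Polynomial.induction_on' with
  | add p q hp hq => simp [hp, hq]
  | monomial n a =>
    have : Commute D ((D * D) ^ n) := ((Commute.refl D).mul_right (Commute.refl D)).pow_right n
    have := congrArg (fun f => f w) this.eq
    simp only [Module.End.mul_apply] at this
    simp [aeval_monomial, this, Module.algebraMap_end_apply]

lemma w_sq {B : LinearMap.BilinForm F V} {D : Module.End F V}
    (hD : ∀ x y, B (D x) y = - B x (D y)) : ∀ x y, B ((D * D) x) y = B x ((D * D) y) := by
  intro x y; simp [hD]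

lemma w_skew (h2 : (2 : F) ≠ 0) (B : LinearMap.BilinForm F V) (hs : ∀ x y, B x y = B y x)
    (D : Module.End F V) (hD : ∀ x y, B (D x) y = - B x (D y)) (p : F[X]) (w : V) :
    B (D (aeval (D * D) p w)) w = 0 := by
  have h : B (D (aeval (D * D) p w)) w = - B (D (aeval (D * D) p w)) w := by
    conv_lhs => rw [hD, w_selfadj B _ (w_sq hD), ← w_comm, hs]
  have : 2 * B (D (aeval (D * D) p w)) w = 0 := by linear_combination h
  exact (mul_eq_zero.1 this).resolve_left h2

lemma w_skew' (h2 : (2 : F) ≠ 0) (B : LinearMap.BilinForm F V) (hs : ∀ x y, B x y = B y x)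
    (D : Module.End F V) (hD : ∀ x y, B (D x) y = - B x (D y)) (p q : F[X]) (w : V) :
    B (aeval (D * D) p w) (aeval (D * D) q (D w)) = 0 := by
  rw [w_selfadj B _ (w_sq hD), ← Module.End.mul_apply, ← map_mul, ← w_comm, hs]
  exact w_skew h2 B hs D hD _ w

lemma w_pair_nondeg (B : LinearMap.BilinForm F V) (hs : ∀ x y, B x y = B y x)
    (P Q : Submodule F V) (h : ∀ x ∈ P, ∀ y ∈ Q, B x y = 0)
    (hP : ∀ x ∈ P, (∀ y ∈ P, B x y = 0) → x = 0) (hQ : ∀ x ∈ Q, (∀ y ∈ Q, B x y = 0) → x = 0) :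
    ∀ x ∈ P ⊔ Q, (∀ y ∈ P ⊔ Q, B x y = 0) → x = 0 := by
  intro x hx hxy
  obtain ⟨a, ha, b, hb, rfl⟩ := Submodule.mem_sup.1 hx
  have h1 : a = 0 := hP a ha fun y hy => by
    have := hxy y (Submodule.mem_sup_left hy)
    rwa [map_add, LinearMap.add_apply, hs b y, h y hy b hb, add_zero] at this
  have h2 : b = 0 := hQ b hb fun y hy => by
    have := hxy y (Submodule.mem_sup_right hy)
    rwa [map_add, LinearMap.add_apply, h a ha y hy, zero_add] at this
  rw [h1, h2, add_zero]

lemma w_rad1 (B : LinearMap.BilinForm F V) (Y : Module.End F V)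
    (hY : ∀ x y, B (Y x) y = B x (Y y)) (f : F[X]) (hf : Irreducible f) (j : ℕ) (w : V)
    (hk : aeval Y (f ^ (j + 1)) w = 0) (hne : B (aeval Y (f ^ j) w) w ≠ 0) (p : F[X])
    (hp : ∀ q : F[X], B (aeval Y p w) (aeval Y q w) = 0) : f ^ (j + 1) ∣ p := by
  have key : ∀ i ≤ j + 1, f ^ i ∣ p := by
    intro i
    induction i with
    | zero => simp
    | succ i ih =>
      intro hi
      obtain ⟨c, hc⟩ := ih (by omega)
      by_cases hfc : f ∣ c
      · rw [hc, pow_succ]; exact mul_dvd_mul_left _ hfc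
      · exfalso
        obtain ⟨a, b, hab⟩ := (hf.coprime_iff_not_dvd).2 hfc
        have h1 := hp (b * f ^ (j - i))
        rw [← w_selfadj B Y hY, ← Module.End.mul_apply, ← map_mul] at h1
        have h3 : b * f ^ (j - i) * p = f ^ j - a * f ^ (j + 1) := by
          have : f ^ j = f ^ (j - i) * f ^ i := by rw [← pow_add]; congr 1; omega
          rw [pow_succ, this, hc]
          linear_combination (f ^ (j - i) * f ^ i) * hab
        rw [h3, map_sub, map_mul, LinearMap.sub_apply, Module.End.mul_apply, hk, map_zero, sub_zero] at h1
        exact hne h1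
  exact key _ le_rfl

lemma w_pair1 (h2 : (2 : F) ≠ 0) (B : LinearMap.BilinForm F V) (hs : ∀ x y, B x y = B y x)
    (D : Module.End F V) (hD : ∀ x y, B (D x) y = - B x (D y))
    (f : F[X]) (hf : Irreducible f) (j : ℕ) (w : V)
    (hk : aeval (D * D) (f ^ (j + 1)) w = 0) (hne : B (aeval (D * D) (f ^ j) w) w ≠ 0)
    (hQ : ∀ p : F[X], f ^ (j + 1) ∣ X * p → D (aeval (D * D) p w) = 0) :
    ∃ P Q : Submodule F V, P ⊔ Q ≠ ⊥ ∧ (∀ x ∈ P ⊔ Q, (∀ y ∈ P ⊔ Q, B x y = 0) → x = 0) ∧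
      WPair B D P Q := by
  have hort : ∀ x ∈ wCyc (D * D) w, ∀ y ∈ (wCyc (D * D) w).map D, B x y = 0 := by
    rintro x hx _ ⟨y, hy, rfl⟩
    obtain ⟨p, rfl⟩ := mem_wCyc.1 hx
    obtain ⟨q, rfl⟩ := mem_wCyc.1 hy
    rw [w_comm]
    exact w_skew' h2 B hs D hD p q w
  have hrad := w_rad1 B (D * D) (w_sq hD) f hf j w hk hne
  refine ⟨wCyc (D * D) w, (wCyc (D * D) w).map D, ?_, w_pair_nondeg B hs _ _ hort ?_ ?_,
    hort, fun x hx => Submodule.mem_map_of_mem hx, ?_⟩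
  · intro h
    have : w ∈ (⊥ : Submodule F V) := h ▸ Submodule.mem_sup_left (wCyc_self _ _)
    rw [Submodule.mem_bot] at this
    subst this; simp at hne
  · intro x hx h
    obtain ⟨p, rfl⟩ := mem_wCyc.1 hx
    obtain ⟨c, rfl⟩ := hrad p fun q => h _ (mem_wCyc.2 ⟨q, rfl⟩)
    rw [mul_comm, map_mul, Module.End.mul_apply, hk, map_zero]
  · rintro _ ⟨x, hx, rfl⟩ h
    obtain ⟨p, rfl⟩ := mem_wCyc.1 hx
    apply hQ
    apply hrad
    intro q
    have := h _ (Submodule.mem_map_of_mem (mem_wCyc.2 ⟨q, rfl⟩))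
    rw [hs, hD, hs, neg_eq_zero] at this
    rw [← this]
    simp
  · rintro _ ⟨x, hx, rfl⟩
    have := wCyc_map (D * D) w X hx
    simpa using this

lemma w_pow (B : LinearMap.BilinForm F V) 
    (D : Module.End F V) (hD : ∀ x y, B (D x) y = - B x (D y)) (i : ℕ) :
    ∀ x y, B ((D ^ i) x) y = (-1) ^ i * B x ((D ^ i) y) := by
  induction i with
  | zero => simp
  | succ n ih =>
    intro x y
    rw [pow_succ, Module.End.mul_apply, ih, hD, ← Module.End.mul_apply, ← pow_succ', pow_succ, pow_succ]
    ring

lemma w_lead (D : Module.End F V) (N : ℕ) (hN : D ^ (N + 1) = 0) (c : F[X]) (u : V) :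
    (D ^ N) (aeval D c u) = c.coeff 0 • (D ^ N) u := by
  have h : aeval D (X ^ N * c) = c.coeff 0 • D ^ N := by
    conv_lhs => rw [← divX_mul_X_add c]
    have : (X : F[X]) ^ N * (c.divX * X + C (c.coeff 0)) = c.divX * X ^ (N + 1) + c.coeff 0 • X ^ N := by
      rw [smul_eq_C_mul]; ring
    rw [this]
    simp [hN]
  have := congrArg (fun f => f u) h
  simpa using this

lemma w_notMem (D : Module.End F V) (k : ℕ) (hk : D ^ (2 * k + 2) = 0) (v : V)
    (hv : (D ^ (2 * k + 1)) v ≠ 0) : (D ^ (2 * k + 1)) v ∉ wCyc (D * D) v := by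
  intro h
  obtain ⟨p, hp⟩ := mem_wCyc.1 h
  have key : ∀ i ≤ k + 1, X ^ i ∣ p := by
    intro i
    induction i with
    | zero => simp
    | succ i ih =>
      intro hi
      obtain ⟨c, hc⟩ := ih (by omega)
      rw [hc, pow_succ]
      refine mul_dvd_mul_left _ (X_dvd_iff.2 ?_)
      have h1 := congrArg (D ^ (2 * k + 1 - 2 * i)) hp
      have h0 : (D ^ (2 * k + 1 - 2 * i)) ((D ^ (2 * k + 1)) v) = 0 := by
        rw [← Module.End.mul_apply, ← pow_add,
          show 2 * k + 1 - 2 * i + (2 * k + 1) = (2 * k - 2 * i) + (2 * k + 2) by omega, pow_add, hk]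
        simp
      rw [h0, hc, map_mul, map_pow, aeval_X, ← pow_two, ← pow_mul, ← Module.End.mul_apply,
        ← mul_assoc, ← pow_add, show 2 * k + 1 - 2 * i + 2 * i = 2 * k + 1 by omega,
        ← expand_aeval, Module.End.mul_apply, w_lead _ _ hk] at h1
      have h3 := (smul_eq_zero.1 h1).resolve_right hv
      simpa [coeff_expand] using h3
  obtain ⟨c, rfl⟩ := key _ le_rfl
  apply hv
  rw [← hp, mul_comm, map_mul, map_pow, aeval_X, ← pow_two, ← pow_mul, show 2 * (k + 1) = 2 * k + 2 by ring, hk]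
  simp

lemma w_pair2 [FiniteDimensional F V] (h2 : (2 : F) ≠ 0) (B : LinearMap.BilinForm F V)
    (hs : ∀ x y, B x y = B y x) (hB : ∀ x, (∀ y, B x y = 0) → x = 0)
    (D : Module.End F V) (hD : ∀ x y, B (D x) y = - B x (D y))
    (k : ℕ) (hk : D ^ (2 * k + 2) = 0) (hne : D ^ (2 * k + 1) ≠ 0) :
    ∃ P Q : Submodule F V, P ⊔ Q ≠ ⊥ ∧ (∀ x ∈ P ⊔ Q, (∀ y ∈ P ⊔ Q, B x y = 0) → x = 0) ∧
      WPair B D P Q := by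
  obtain ⟨v, hv⟩ : ∃ v, (D ^ (2 * k + 1)) v ≠ 0 := by
    by_contra! h
    exact hne (LinearMap.ext h)
  obtain ⟨φ, hφ, hφ'⟩ := Submodule.exists_le_ker_of_notMem (w_notMem D k hk v hv)
  have hnd : B.Nondegenerate := ⟨hB, fun x h => hB x fun y => by rw [hs]; exact h y⟩
  obtain ⟨u, rfl⟩ := (B.toDual hnd).surjective φ
  simp only [LinearMap.BilinForm.toDual_def] at hφ
  have hu : ∀ p : F[X], B u (aeval (D * D) p v) = 0 := fun p => by
    have : aeval (D * D) p v ∈ LinearMap.ker ((B.toDual hnd) u) := hφ' (mem_wCyc.2 ⟨p, rfl⟩)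
    simpa [LinearMap.BilinForm.toDual_def] using this
  have hsa := w_selfadj B _ (w_sq hD)
  set P := wCyc (D * D) u ⊔ wCyc (D * D) (D v) with hP
  set Q := wCyc (D * D) (D u) ⊔ wCyc (D * D) v with hQ
  have hPQ : WPair B D P Q := by
    refine ⟨?_, ?_, ?_⟩
    · intro x hx y hy
      obtain ⟨a, ha, b, hb, rfl⟩ := Submodule.mem_sup.1 hx
      obtain ⟨c, hc, d, hd, rfl⟩ := Submodule.mem_sup.1 hy
      obtain ⟨a, rfl⟩ := mem_wCyc.1 ha
      obtain ⟨b, rfl⟩ := mem_wCyc.1 hb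
      obtain ⟨c, rfl⟩ := mem_wCyc.1 hc
      obtain ⟨d, rfl⟩ := mem_wCyc.1 hd
      have e1 := w_skew' h2 B hs D hD a c u
      have e2 : B (aeval (D * D) a u) (aeval (D * D) d v) = 0 := by
        rw [hsa, ← Module.End.mul_apply, ← map_mul, hu]
      have e3 : B (aeval (D * D) b (D v)) (aeval (D * D) c (D u)) = 0 := by
        rw [← w_comm, hs, hsa, hD, ← Module.End.mul_apply, ← Module.End.mul_apply, ← Module.End.mul_apply]
        have : D * (aeval (D * D) c * D * aeval (D * D) b) = aeval (D * D) (c * X * b) := by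
          ext z
          simp [w_comm]
        have := congrArg (fun f => B u (f v)) this
        simp only [hu] at this
        rw [← Module.End.mul_apply, ← mul_assoc] at *
        simp [mul_assoc] at this ⊢
        exact this
      have e4 := w_skew' h2 B hs D hD d b v
      rw [hs] at e4
      simp [e1, e2, e3, e4]
    · intro x hx
      obtain ⟨a, ha, b, hb, rfl⟩ := Submodule.mem_sup.1 hx
      obtain ⟨a, rfl⟩ := mem_wCyc.1 ha
      obtain ⟨b, rfl⟩ := mem_wCyc.1 hb
      rw [map_add]
      refine Submodule.add_mem_sup (mem_wCyc.2 ⟨a, by rw [w_comm]⟩) (mem_wCyc.2 ⟨X * b, ?_⟩)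
      simp [w_comm]
    · intro x hx
      obtain ⟨a, ha, b, hb, rfl⟩ := Submodule.mem_sup.1 hx
      obtain ⟨a, rfl⟩ := mem_wCyc.1 ha
      obtain ⟨b, rfl⟩ := mem_wCyc.1 hb
      rw [map_add]
      refine Submodule.add_mem_sup (mem_wCyc.2 ⟨X * a, ?_⟩) (mem_wCyc.2 ⟨b, by rw [w_comm]⟩)
      simp [w_comm]
  have hinv : ∀ i : ℕ, ∀ x ∈ P ⊔ Q, (D ^ i) x ∈ P ⊔ Q := by
    intro i
    induction i with
    | zero => simp
    | succ i ih =>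
      intro x hx
      obtain ⟨a, ha, b, hb, rfl⟩ := Submodule.mem_sup.1 hx
      rw [pow_succ, Module.End.mul_apply, map_add, add_comm]
      exact ih _ (Submodule.add_mem_sup (hPQ.2.2 b hb) (hPQ.2.1 a ha))
  have huU : u ∈ P ⊔ Q := Submodule.mem_sup_left (Submodule.mem_sup_left (wCyc_self _ _))
  have hvU : v ∈ P ⊔ Q := Submodule.mem_sup_right (Submodule.mem_sup_right (wCyc_self _ _))
  refine ⟨P, Q, ?_, ?_, hPQ⟩
  · intro h
    rw [h, Submodule.mem_bot] at hvU
    subst hvU; simp at hv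
  · intro x hx hxU
    have hle : P ⊔ Q ≤ wCyc D u ⊔ wCyc D v := by
      have h1 : ∀ z, wCyc (D * D) z ≤ wCyc D z := by
        intro z x hx
        obtain ⟨p, rfl⟩ := mem_wCyc.1 hx
        exact mem_wCyc.2 ⟨expand F 2 p, by rw [expand_aeval, pow_two]⟩
      have h3 : ∀ z, wCyc (D * D) (D z) ≤ wCyc D z := by
        intro z x hx
        obtain ⟨p, rfl⟩ := mem_wCyc.1 hx
        exact mem_wCyc.2 ⟨expand F 2 p * X, by rw [map_mul, expand_aeval, pow_two]; simp⟩
      exact sup_le (sup_le_sup (h1 u) (h3 v)) (sup_le_sup (h3 u) (h1 v))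
    obtain ⟨a, ha, b, hb, rfl⟩ := Submodule.mem_sup.1 (hle hx)
    obtain ⟨a, rfl⟩ := mem_wCyc.1 ha
    obtain ⟨b, rfl⟩ := mem_wCyc.1 hb
    have hz : ∀ z, B ((D ^ (2 * k + 1)) z) z = 0 := by
      intro z
      have := w_skew h2 B hs D hD (X ^ k) z
      rw [map_pow, aeval_X, ← pow_two, ← pow_mul, ← Module.End.mul_apply, ← pow_succ'] at this
      exact this
    have huv : B ((D ^ (2 * k + 1)) u) v ≠ 0 := by
      rw [w_pow B D hD]
      exact mul_ne_zero (by simp) hφ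
    have hvu : B ((D ^ (2 * k + 1)) v) u ≠ 0 := by rw [hs]; exact hφ
    have key : ∀ i ≤ 2 * k + 2, X ^ i ∣ a ∧ X ^ i ∣ b := by
      intro i
      induction i with
      | zero => simp
      | succ i ih =>
        intro hi
        obtain ⟨⟨a', ha'⟩, ⟨b', hb'⟩⟩ := ih (by omega)
        have hL : ∀ c : F[X], ∀ z, (D ^ (2 * k + 1 - i)) (aeval D (X ^ i * c) z) = c.coeff 0 • (D ^ (2 * k + 1)) z := by
          intro c z
          rw [← w_lead D _ hk, map_mul, map_pow, aeval_X, ← Module.End.mul_apply, ← mul_assoc, ← pow_add,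
            show 2 * k + 1 - i + i = 2 * k + 1 by omega, Module.End.mul_apply]
        have hT : ∀ z ∈ P ⊔ Q, B (a'.coeff 0 • (D ^ (2 * k + 1)) u + b'.coeff 0 • (D ^ (2 * k + 1)) v) z = 0 := by
          intro z hzU
          rw [← hL, ← hL, ← ha', ← hb', ← map_add, w_pow B D hD, hxU _ (hinv _ _ hzU), mul_zero]
        have t1 := hT v hvU
        have t2 := hT u huU
        simp only [map_add, map_smul, LinearMap.add_apply, LinearMap.smul_apply, hz, smul_eq_mul, mul_zero,
          add_zero, zero_add] at t1 t2
        constructor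
        · rw [ha', pow_succ]
          exact mul_dvd_mul_left _ (X_dvd_iff.2 ((mul_eq_zero.1 t1).resolve_right huv))
        · rw [hb', pow_succ]
          exact mul_dvd_mul_left _ (X_dvd_iff.2 ((mul_eq_zero.1 t2).resolve_right hvu))
    obtain ⟨⟨a', rfl⟩, ⟨b', rfl⟩⟩ := key _ le_rfl
    simp [hk]

end Wonenburger

section Wonenburger2

universe u₁ u₂

variable {F : Type u₁} {V : Type u₂} [Field F] [AddCommGroup V] [Module F V]

lemma w_mult {f a : F[X]} (hf : Prime f) (h0 : a ≠ 0) : ∃ (k : ℕ) (m : F[X]), ¬ f ∣ m ∧ a = f ^ k * m := by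
  obtain ⟨m, h1, h3⟩ := (FiniteMultiplicity.of_prime_left hf h0).exists_eq_pow_mul_and_not_dvd
  exact ⟨_, m, h3, h1⟩

lemma w_exists_f [FiniteDimensional F V] (Y : Module.End F V) (hY : ¬ IsNilpotent Y) :
    ∃ f : F[X], Irreducible f ∧ f ∣ minpoly F Y ∧ ¬ f ∣ X := by
  by_contra! h
  have h0 : minpoly F Y ≠ 0 := minpoly.ne_zero (Algebra.IsIntegral.isIntegral Y)
  obtain ⟨k, m, hm, hk⟩ := w_mult (prime_X (R := F)) h0
  by_cases hu : IsUnit m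
  · apply hY
    refine ⟨k, ?_⟩
    have : minpoly F Y ∣ X ^ k := by
      rw [hk]; exact (hu.mul_right_dvd).2 dvd_rfl
    simpa using (minpoly.dvd_iff).1 this
  · have hm0 : m ≠ 0 := by rintro rfl; simp at hm
    obtain ⟨f, hf, hfm⟩ := WfDvdMonoid.exists_irreducible_factor hu hm0
    have := h f hf (hk ▸ hfm.mul_left _)
    exact hm (((hf.associated_of_dvd irreducible_X this).symm.dvd).trans hfm)

lemma w_step [FiniteDimensional F V] [Nontrivial V] (h2 : (2 : F) ≠ 0) (B : LinearMap.BilinForm F V)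
    (hs : ∀ x y, B x y = B y x) (hB : ∀ x, (∀ y, B x y = 0) → x = 0)
    (D : Module.End F V) (hD : ∀ x y, B (D x) y = - B x (D y)) :
    ∃ P Q : Submodule F V, P ⊔ Q ≠ ⊥ ∧ (∀ x ∈ P ⊔ Q, (∀ y ∈ P ⊔ Q, B x y = 0) → x = 0) ∧
      WPair B D P Q := by
  have hsa := w_selfadj B _ (w_sq hD)
  by_cases hn : IsNilpotent D
  · have hd0 : nilpotencyClass D ≠ 0 := (pos_nilpotencyClass_iff.2 hn).ne'
    have hd := pow_nilpotencyClass hn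
    have hd1 := pow_pred_nilpotencyClass hn
    rcases Nat.even_or_odd' (nilpotencyClass D) with ⟨m, hm | hm⟩
    · obtain ⟨k, rfl⟩ : ∃ k, m = k + 1 := ⟨m - 1, by omega⟩
      rw [hm] at hd hd1
      exact w_pair2 h2 B hs hB D hD k (by convert hd using 2; omega) (by convert hd1 using 2; omega)
    · rw [hm] at hd hd1
      have hE : aeval (D * D) (X ^ m : F[X]) ≠ 0 := by
        rw [map_pow, aeval_X, ← pow_two, ← pow_mul]
        exact hd1
      obtain ⟨w, hw⟩ := w_polar h2 B hs hB _ (hsa (X ^ m)) hE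
      refine w_pair1 h2 B hs D hD X irreducible_X m w ?_ hw ?_
      · rw [map_pow, aeval_X, ← pow_two, ← pow_mul, show 2 * (m + 1) = 2 * m + 1 + 1 by ring, pow_succ, hd]
        simp
      · intro p hp
        rw [pow_succ', mul_dvd_mul_iff_left X_ne_zero] at hp
        obtain ⟨c, rfl⟩ := hp
        rw [map_mul, map_pow, aeval_X, ← pow_two, ← pow_mul, ← Module.End.mul_apply, ← mul_assoc, ← pow_succ', hd]
        simp
  · have hn' : ¬ IsNilpotent (D * D) := by
      rintro ⟨k, hk⟩
      exact hn ⟨2 * k, by rw [pow_mul, pow_two, hk]⟩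
    obtain ⟨f, hf, hfm, hfX⟩ := w_exists_f (D * D) hn'
    have h0 : minpoly F (D * D) ≠ 0 := minpoly.ne_zero (Algebra.IsIntegral.isIntegral _)
    obtain ⟨k, m, hm, hk⟩ := w_mult hf.prime h0
    obtain ⟨j, rfl⟩ : ∃ j, k = j + 1 := by
      rcases k with _ | j
      · simp at hk; rw [hk] at hfm; exact absurd hfm hm
      · exact ⟨j, rfl⟩
    have hE : aeval (D * D) (m * f ^ j * m) ≠ 0 := by
      intro h
      have := (minpoly.dvd_iff).2 h
      rw [hk, pow_succ, show m * f ^ j * m = f ^ j * (m * m) by ring, mul_assoc,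
        mul_dvd_mul_iff_left (pow_ne_zero _ hf.ne_zero)] at this
      rcases hf.prime.dvd_or_dvd ((dvd_mul_right _ _).trans this) with h | h <;> exact hm h
    obtain ⟨v, hv⟩ := w_polar h2 B hs hB _ (hsa _) hE
    refine w_pair1 h2 B hs D hD f hf j (aeval (D * D) m v) ?_ ?_ ?_
    · rw [← Module.End.mul_apply, ← map_mul, ← hk, minpoly.aeval]; rfl
    · rw [mul_assoc, map_mul, map_mul, Module.End.mul_apply, Module.End.mul_apply, hsa] at hv
      exact hv
    · intro p hp
      have hc : IsCoprime (f ^ (j + 1)) X := ((hf.coprime_iff_not_dvd).2 hfX).pow_left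
      obtain ⟨c, rfl⟩ := hc.dvd_of_dvd_mul_left hp
      rw [← Module.End.mul_apply (aeval (D * D) (f ^ (j + 1) * c)), ← map_mul,
        show f ^ (j + 1) * c * m = c * (f ^ (j + 1) * m) by ring, ← hk, map_mul, minpoly.aeval]
      simp

lemma w_exists_pair (h2 : (2 : F) ≠ 0) (n : ℕ) : ∀ (V : Type u₂) [AddCommGroup V] [Module F V]
    [FiniteDimensional F V] (_ : Module.finrank F V = n) (B : LinearMap.BilinForm F V)
    (_ : ∀ x y, B x y = B y x) (_ : ∀ x, (∀ y, B x y = 0) → x = 0)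
    (D : Module.End F V) (_ : ∀ x y, B (D x) y = - B x (D y)),
    ∃ P Q : Submodule F V, P ⊔ Q = ⊤ ∧ WPair B D P Q := by
  induction n using Nat.strong_induction_on with
  | _ n ih =>
  intro V _ _ _ hn B hs hB D hD
  rcases subsingleton_or_nontrivial V with hV | hV
  · refine ⟨⊤, ⊤, by simp, ?_, by simp, by simp⟩
    intro x _ y _
    rw [Subsingleton.elim x 0]; simp
  obtain ⟨P, Q, hne, hnd, hort, hPQ, hQP⟩ := w_step h2 B hs hB D hD
  have hc := w_compl B hs _ hnd
  set W := B.orthogonal (P ⊔ Q) with hW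
  have hDU : ∀ x ∈ P ⊔ Q, D x ∈ P ⊔ Q := by
    intro x hx
    obtain ⟨a, ha, b, hb, rfl⟩ := Submodule.mem_sup.1 hx
    rw [map_add, add_comm]
    exact Submodule.add_mem_sup (hQP b hb) (hPQ a ha)
  have hDW : ∀ x ∈ W, D x ∈ W := by
    intro x hx y hy
    have := w_orth (hDU y hy) hx
    rw [hD, neg_eq_zero] at this
    exact this
  have hlt : Module.finrank F W < n := by
    rw [← hn]
    apply Submodule.finrank_lt
    intro h
    apply hne
    have := hc.inf_eq_bot
    rw [h, inf_top_eq] at this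
    exact this
  obtain ⟨P', Q', hsup, hort', hPQ', hQP'⟩ := ih _ hlt W rfl (B.restrict W) (fun x y => hs _ _)
    (fun x h => Subtype.ext (w_nondeg_orth B hs hB _ hc x x.2 fun y hy => h ⟨y, hy⟩))
    (D.restrict hDW) (fun x y => hD _ _)
  have hmap : P'.map W.subtype ⊔ Q'.map W.subtype = W := by
    rw [← Submodule.map_sup, hsup, Submodule.map_top, Submodule.range_subtype]
  refine ⟨P ⊔ P'.map W.subtype, Q ⊔ Q'.map W.subtype, ?_, ?_, ?_, ?_⟩
  · rw [sup_sup_sup_comm, hmap, hc.sup_eq_top]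
  · intro x hx y hy
    obtain ⟨a, ha, _, ⟨b, hb, rfl⟩, rfl⟩ := Submodule.mem_sup.1 hx
    obtain ⟨c, hcc, _, ⟨d, hd, rfl⟩, rfl⟩ := Submodule.mem_sup.1 hy
    have e1 := hort a ha c hcc
    have e2 : B a d = 0 := w_orth (Submodule.mem_sup_left ha) d.2
    have e3 : B c b = 0 := w_orth (Submodule.mem_sup_right hcc) b.2
    rw [hs] at e3
    have e4 : B b d = 0 := hort' b hb d hd
    simp [e1, e2, e3, e4]
  · intro x hx
    obtain ⟨a, ha, _, ⟨b, hb, rfl⟩, rfl⟩ := Submodule.mem_sup.1 hx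
    rw [map_add]
    exact Submodule.add_mem_sup (hPQ a ha) ⟨_, hPQ' b hb, rfl⟩
  · intro x hx
    obtain ⟨a, ha, _, ⟨b, hb, rfl⟩, rfl⟩ := Submodule.mem_sup.1 hx
    rw [map_add]
    exact Submodule.add_mem_sup (hQP a ha) ⟨_, hQP' b hb, rfl⟩

/-- glue -/
lemma w_glue (B : LinearMap.BilinForm F V) (hs : ∀ x y, B x y = B y x) (U W : Submodule F V)
    (hc : IsCompl U W) (hort : ∀ x ∈ U, ∀ y ∈ W, B x y = 0)
    (h₁ : Module.End F U) (h₂ : Module.End F W) (hh₁ : ∀ x, h₁ (h₁ x) = x) (hh₂ : ∀ x, h₂ (h₂ x) = x)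
    (hb₁ : ∀ x y, B (h₁ x) (h₁ y) = B x y) (hb₂ : ∀ x y, B (h₂ x) (h₂ y) = B x y) :
    ∃ h : Module.End F V, (∀ x, h (h x) = x) ∧ (∀ x y, B (h x) (h y) = B x y) ∧
      (∀ x : U, h x = h₁ x) ∧ (∀ x : W, h x = h₂ x) := by
  let h := LinearMap.ofIsCompl hc (U.subtype ∘ₗ h₁) (W.subtype ∘ₗ h₂)
  have e1 : ∀ x : U, h x = h₁ x := fun x => by simp [h]
  have e2 : ∀ x : W, h x = h₂ x := fun x => by simp [h]
  have hd : ∀ x : V, ∃ (a : U) (b : W), x = a + b := by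
    intro x
    have : x ∈ U ⊔ W := by rw [hc.sup_eq_top]; trivial
    obtain ⟨a, ha, b, hb, rfl⟩ := Submodule.mem_sup.1 this
    exact ⟨⟨a, ha⟩, ⟨b, hb⟩, rfl⟩
  refine ⟨h, ?_, ?_, e1, e2⟩
  · intro x
    obtain ⟨a, b, rfl⟩ := hd x
    simp [e1, e2, hh₁, hh₂]
  · intro x y
    obtain ⟨a, b, rfl⟩ := hd x
    obtain ⟨c, d, rfl⟩ := hd y
    have o1 : ∀ (x : U) (y : W), B x y = 0 := fun x y => hort x x.2 y y.2
    have o2 : ∀ (x : U) (y : W), B y x = 0 := fun x y => by rw [hs]; exact o1 x y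
    simp [e1, e2, hb₁, hb₂, o1, o2]

lemma w_skew_inv [FiniteDimensional F V] (h2 : (2 : F) ≠ 0) (B : LinearMap.BilinForm F V)
    (hs : ∀ x y, B x y = B y x) (hB : ∀ x, (∀ y, B x y = 0) → x = 0)
    (D : Module.End F V) (hD : ∀ x y, B (D x) y = - B x (D y)) :
    ∃ h : Module.End F V, (∀ x, h (h x) = x) ∧ (∀ x y, B (h x) (h y) = B x y) ∧
      ∀ x, h (D x) = - D (h x) := by
  obtain ⟨P, Q, hsup, hort, hPQ, hQP⟩ := w_exists_pair h2 _ V rfl B hs hB D hD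
  have hc : IsCompl P Q := by
    refine ⟨?_, codisjoint_iff.2 hsup⟩
    rw [Submodule.disjoint_def]
    intro x hx hx'
    refine hB x fun y => ?_
    have : y ∈ P ⊔ Q := by rw [hsup]; trivial
    obtain ⟨a, ha, b, hb, rfl⟩ := Submodule.mem_sup.1 this
    rw [map_add, hort x hx b hb, hs, hort a ha x hx', add_zero]
  obtain ⟨h, hh, hb, e1, e2⟩ := w_glue B hs P Q hc hort LinearMap.id (-LinearMap.id) (by simp) (by simp) (by simp) (by simp)
  refine ⟨h, hh, hb, ?_⟩
  have e1' : ∀ x ∈ P, h x = x := fun x hx => e1 ⟨x, hx⟩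
  have e2' : ∀ x ∈ Q, h x = - x := fun x hx => by simpa using e2 ⟨x, hx⟩
  intro x
  have : x ∈ P ⊔ Q := by rw [hsup]; trivial
  obtain ⟨a, ha, b, hb, rfl⟩ := Submodule.mem_sup.1 this
  simp only [map_add, e1' a ha, e2' b hb, e2' _ (hPQ a ha), e1' _ (hQP b hb), map_neg]
  abel

/-- Cayley transform case. -/
lemma w_cayley [FiniteDimensional F V] (h2 : (2 : F) ≠ 0) (B : LinearMap.BilinForm F V)
    (hs : ∀ x y, B x y = B y x) (hB : ∀ x, (∀ y, B x y = 0) → x = 0)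
    (g : Module.End F V) (hg : ∀ x y, B (g x) (g y) = B x y) (h1 : ∀ x, g x + x = 0 → x = 0) :
    ∃ h : Module.End F V, (∀ x, h (h x) = x) ∧ (∀ x y, B (h x) (h y) = B x y) ∧
      ∀ x, h (g (h (g x))) = x := by
  have hinj : Function.Injective ⇑(g + 1 : Module.End F V) := by
    rw [← LinearMap.ker_eq_bot, LinearMap.ker_eq_bot']
    intro x hx; exact h1 x (by simpa using hx)
  let e := LinearEquiv.ofInjectiveEndo (g + 1) hinj
  have he : ∀ x, e x = g x + x := fun x => by simp [e]
  let D : Module.End F V := (g - 1) ∘ₗ e.symm.toLinearMap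
  have hDe : ∀ x, D (g x + x) = g x - x := by
    intro x
    rw [← he]; simp [D]
  have hsurj : ∀ y, ∃ x, y = g x + x := fun y => ⟨e.symm y, by rw [← he]; simp⟩
  have hD : ∀ x y, B (D x) y = - B x (D y) := by
    intro x y
    obtain ⟨x, rfl⟩ := hsurj x
    obtain ⟨y, rfl⟩ := hsurj y
    rw [hDe, hDe]
    simp only [map_add, map_sub, LinearMap.add_apply, LinearMap.sub_apply, hg]
    ring
  obtain ⟨h, hh, hb, hDh⟩ := w_skew_inv h2 B hs hB D hD
  refine ⟨h, hh, hb, ?_⟩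
  -- g (z - D z) = z + D z
  have hgD : ∀ z, g (z - D z) = z + D z := by
    intro z
    obtain ⟨x, rfl⟩ := hsurj z
    rw [hDe]
    simp only [map_add, map_sub]
    abel
  -- every x is z - D z
  intro x
  obtain ⟨z, rfl⟩ : ∃ z, x = z - D z := by
    refine ⟨(2 : F)⁻¹ • (g x + x), ?_⟩
    rw [map_smul, hDe, ← smul_sub, show g x + x - (g x - x) = (2 : F) • x by rw [two_smul]; abel, smul_smul,
      inv_mul_cancel₀ h2, one_smul]
  have e3 : h (z + D z) = h z - D (h z) := by rw [map_add, hDh, sub_eq_add_neg]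
  rw [hgD, e3, hgD, map_add, hDh, hh, sub_eq_add_neg]

/-- Wonenburger. -/
lemma w_main [FiniteDimensional F V] (h2 : (2 : F) ≠ 0) (B : LinearMap.BilinForm F V)
    (hs : ∀ x y, B x y = B y x) (hB : ∀ x, (∀ y, B x y = 0) → x = 0)
    (g : Module.End F V) (hg : ∀ x y, B (g x) (g y) = B x y) :
    ∃ h : Module.End F V, (∀ x, h (h x) = x) ∧ (∀ x y, B (h x) (h y) = B x y) ∧
      ∀ x, h (g (h (g x))) = x := by
  have hginj : Function.Injective g := by
    rw [← LinearMap.ker_eq_bot, LinearMap.ker_eq_bot']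
    intro x hx
    refine hB x fun y => ?_
    rw [← hg, hx]; simp
  have hgsurj := LinearMap.surjective_of_injective hginj
  set S : Module.End F V := g + 1 with hS
  have hSx : ∀ x, S x = g x + x := fun x => by simp [hS]
  obtain ⟨N, hN1, hc⟩ := ((Filter.eventually_ge_atTop 1).and
    (LinearMap.eventually_isCompl_ker_pow_range_pow S)).exists
  set U := LinearMap.ker (S ^ N) with hU
  set W := LinearMap.range (S ^ N) with hW
  have hcomm : Commute g (S ^ N) := ((Commute.refl g).add_right (Commute.one_right g)).pow_right N
  have hcomm' : ∀ x, g ((S ^ N) x) = (S ^ N) (g x) := fun x => congrArg (fun f => f x) hcomm.eq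
  have hgU : ∀ x ∈ U, g x ∈ U := by
    intro x hx
    rw [hU, LinearMap.mem_ker] at hx ⊢
    rw [← hcomm', hx, map_zero]
  have hgW : ∀ x ∈ W, g x ∈ W := by
    rintro _ ⟨x, rfl⟩
    exact ⟨g x, (hcomm' x).symm⟩
  have hadj : ∀ i : ℕ, ∀ x y, B x ((S ^ i) y) = B ((S ^ i) x) ((g ^ i) y) := by
    intro i
    induction i with
    | zero => simp
    | succ i ih =>
      intro x y
      have hgS : Commute g S := (Commute.refl g).add_right (Commute.one_right g)
      have h3 : (g ^ i) (S y) = S ((g ^ i) y) := congrArg (fun f => f y) (hgS.pow_left i).eq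
      rw [pow_succ, Module.End.mul_apply, ih, h3, ← pow_succ, pow_succ', pow_succ', Module.End.mul_apply,
        Module.End.mul_apply, hSx, hSx, map_add, map_add, LinearMap.add_apply, hg]
      ring
  have hort : ∀ x ∈ U, ∀ y ∈ W, B x y = 0 := by
    rintro x hx _ ⟨y, rfl⟩
    rw [hU, LinearMap.mem_ker] at hx
    rw [hadj, hx]; simp
  have hdec : ∀ y : V, ∃ a ∈ U, ∃ b ∈ W, a + b = y := by
    intro y
    have : y ∈ U ⊔ W := by rw [hc.sup_eq_top]; trivial
    exact Submodule.mem_sup.1 this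
  have hUn : ∀ x : U, (∀ y : U, B.restrict U x y = 0) → x = 0 := by
    intro x h
    refine Subtype.ext (hB x fun y => ?_)
    obtain ⟨a, ha, b, hb, rfl⟩ := hdec y
    rw [map_add, hort x x.2 b hb, add_zero]
    exact h ⟨a, ha⟩
  have hWn : ∀ x : W, (∀ y : W, B.restrict W x y = 0) → x = 0 := by
    intro x h
    refine Subtype.ext (hB x fun y => ?_)
    obtain ⟨a, ha, b, hb, rfl⟩ := hdec y
    rw [map_add, hs x a, hort a ha x x.2, zero_add]
    exact h ⟨b, hb⟩
  obtain ⟨h₁, hh₁, hb₁, hi₁⟩ := w_cayley h2 (B.restrict U) (fun x y => hs _ _) hUn (-(g.restrict hgU))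
    (fun x y => by
      have := hg x y
      simpa using this) (by
      intro x hx
      have hx' : g x = x := by
        have := congrArg Subtype.val hx
        simp only [LinearMap.neg_apply, Submodule.coe_add, Submodule.coe_neg, LinearMap.coe_restrict_apply, Submodule.coe_zero] at this
        exact (neg_add_eq_zero.1 this)
      have hpow : ∀ i : ℕ, (S ^ i) (x : V) = (2 : F) ^ i • (x : V) := by
        intro i
        induction i with
        | zero => simp
        | succ i ih =>
          rw [pow_succ, Module.End.mul_apply, hSx, hx', ← two_smul F, map_smul, ih, smul_smul, pow_succ']
      have hx0 : (S ^ N) (x : V) = 0 := x.2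
      rw [hpow] at hx0
      exact Subtype.ext ((smul_eq_zero.1 hx0).resolve_left (pow_ne_zero _ h2)))
  obtain ⟨h₂, hh₂, hb₂, hi₂⟩ := w_cayley h2 (B.restrict W) (fun x y => hs _ _) hWn (g.restrict hgW)
    (fun x y => hg x y) (by
      intro x hx
      have hx' : S x = 0 := by rw [hSx]; exact congrArg Subtype.val hx
      have hxU : (x : V) ∈ U := by
        obtain ⟨M, rfl⟩ : ∃ M, N = M + 1 := ⟨N - 1, by omega⟩
        rw [hU, LinearMap.mem_ker, pow_succ, Module.End.mul_apply, hx', map_zero]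
      exact Subtype.ext (Submodule.disjoint_def.1 hc.disjoint _ hxU x.2))
  obtain ⟨h, hh, hb, e1, e2⟩ := w_glue B hs U W hc hort h₁ h₂ hh₁ hh₂ hb₁ hb₂
  refine ⟨h, hh, hb, ?_⟩
  intro x
  obtain ⟨a, ha, b, hb, rfl⟩ := hdec x
  have k1 : h (g (h (g a))) = a := by
    have t1 : g a = (g.restrict hgU ⟨a, ha⟩ : U) := rfl
    have t2 : g (h₁ (g.restrict hgU ⟨a, ha⟩)) = (g.restrict hgU (h₁ (g.restrict hgU ⟨a, ha⟩)) : U) := rfl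
    rw [t1, e1, t2, e1]
    have := congrArg Subtype.val (hi₁ ⟨a, ha⟩)
    simpa using this
  have k2 : h (g (h (g b))) = b := by
    have t1 : g b = (g.restrict hgW ⟨b, hb⟩ : W) := rfl
    have t2 : g (h₂ (g.restrict hgW ⟨b, hb⟩)) = (g.restrict hgW (h₂ (g.restrict hgW ⟨b, hb⟩)) : W) := rfl
    rw [t1, e2, t2, e2]
    exact congrArg Subtype.val (hi₂ ⟨b, hb⟩)
  simp [k1, k2]

end Wonenburger2

section Dimension

variable {F V : Type*} [Field F] [AddCommGroup V] [Module F V] [FiniteDimensional F V]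

open Module

lemma d_map (A : Module.End F V) (S : Submodule F V) :
    finrank F (S.map A) + finrank F (S ⊓ LinearMap.ker A : Submodule F V) = finrank F S := by
  have h := LinearMap.finrank_range_add_finrank_ker (A.domRestrict S)
  rw [LinearMap.range_domRestrict, LinearMap.ker_domRestrict] at h
  rw [← h, ← Submodule.finrank_map_subtype_eq S (Submodule.comap _ _), Submodule.map_comap_subtype]

lemma d_main (A : Module.End F V) (P Q : Submodule F V) (hc : IsCompl P Q)
    (hPQ : P.map A ≤ Q) (hQP : Q.map A ≤ P)
    (hr : ∀ k, Even k → finrank F (LinearMap.range (A ^ k)) + finrank F (LinearMap.range (A ^ (k + 2))) =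
      2 * finrank F (LinearMap.range (A ^ (k + 1)))) :
    finrank F P = finrank F Q := by
  set a : ℕ → ℕ := fun k => finrank F (P.map (A ^ k)) with ha
  set b : ℕ → ℕ := fun k => finrank F (Q.map (A ^ k)) with hb
  have hms : ∀ (S : Submodule F V) k, (S.map (A ^ k)).map A = S.map (A ^ (k + 1)) := by
    intro S k
    rw [← Submodule.map_comp, pow_succ']; rfl
  have hms' : ∀ (S : Submodule F V) k, (S.map A).map (A ^ k) = S.map (A ^ (k + 1)) := by
    intro S k
    rw [← Submodule.map_comp, pow_succ]; rfl
  have hincP : ∀ k, P.map (A ^ (k + 1)) ≤ Q.map (A ^ k) := fun k => by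
    rw [← hms']; exact Submodule.map_mono hPQ
  have hincQ : ∀ k, Q.map (A ^ (k + 1)) ≤ P.map (A ^ k) := fun k => by
    rw [← hms']; exact Submodule.map_mono hQP
  have hdisj : ∀ k, Disjoint (P.map (A ^ k)) (Q.map (A ^ k)) := by
    have : ∀ k, (P.map (A ^ k) ≤ P ∧ Q.map (A ^ k) ≤ Q) ∨ (P.map (A ^ k) ≤ Q ∧ Q.map (A ^ k) ≤ P) := by
      intro k
      induction k with
      | zero => left; simp [Module.End.one_eq_id]
      | succ k ih =>
        rw [← hms, ← hms]
        rcases ih with ⟨h1, h3⟩ | ⟨h1, h3⟩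
        · right; exact ⟨(Submodule.map_mono h1).trans hPQ, (Submodule.map_mono h3).trans hQP⟩
        · left; exact ⟨(Submodule.map_mono h1).trans hQP, (Submodule.map_mono h3).trans hPQ⟩
    intro k
    rcases this k with ⟨h1, h3⟩ | ⟨h1, h3⟩
    · exact hc.disjoint.mono h1 h3
    · exact hc.disjoint.symm.mono h1 h3
  have hrank : ∀ k, finrank F (LinearMap.range (A ^ k)) = a k + b k := by
    intro k
    rw [← Submodule.map_top, ← hc.sup_eq_top, Submodule.map_sup]
    have := Submodule.finrank_sup_add_finrank_inf_eq (P.map (A ^ k)) (Q.map (A ^ k))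
    rw [(hdisj k).eq_bot, finrank_bot, add_zero] at this
    exact this
  have hkP : ∀ k, a (k + 1) + finrank F (P.map (A ^ k) ⊓ LinearMap.ker A : Submodule F V) = a k := by
    intro k; simp only [ha]; rw [← hms]; exact d_map A _
  have hkQ : ∀ k, b (k + 1) + finrank F (Q.map (A ^ k) ⊓ LinearMap.ker A : Submodule F V) = b k := by
    intro k; simp only [hb]; rw [← hms]; exact d_map A _
  have hstep : ∀ k, Even k → (a k : ℤ) - b k = a (k + 2) - b (k + 2) := by
    intro k hk
    have h := hr k hk
    rw [hrank, hrank, hrank] at h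
    have i1 := hkP k
    have i2 := hkQ k
    have i3 := hkP (k + 1)
    have i4 := hkQ (k + 1)
    have i5 := Submodule.finrank_mono (inf_le_inf_right (LinearMap.ker A) (hincP k))
    have i6 := Submodule.finrank_mono (inf_le_inf_right (LinearMap.ker A) (hincQ k))
    simp only [show k + 1 + 1 = k + 2 from rfl] at *
    omega
  have hall : ∀ m, (a 0 : ℤ) - b 0 = a (2 * m) - b (2 * m) := by
    intro m
    induction m with
    | zero => simp
    | succ m ih => rw [ih, hstep (2 * m) (by simp)]; rfl
  have hstab : ∃ m, a (2 * m) + b (2 * m) = a (2 * m + 1) + b (2 * m + 1) := by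
    by_contra! h
    have : ∀ m, a (2 * m) + b (2 * m) + m ≤ a 0 + b 0 := by
      intro m
      induction m with
      | zero => simp
      | succ m ih =>
        have i1 := hkP (2 * m)
        have i2 := hkQ (2 * m)
        have i3 := hkP (2 * m + 1)
        have i4 := hkQ (2 * m + 1)
        have i5 := h m
        simp only [show 2 * (m + 1) = 2 * m + 1 + 1 from rfl] at *
        omega
    have := this (a 0 + b 0 + 1)
    omega
  obtain ⟨m, hm⟩ := hstab
  have i1 := hkP (2 * m)
  have i2 := hkQ (2 * m)
  have j1 : a (2 * m + 1) ≤ b (2 * m) := Submodule.finrank_mono (hincP _)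
  have j2 : b (2 * m + 1) ≤ a (2 * m) := Submodule.finrank_mono (hincQ _)
  have h0 := hall m
  have ha0 : a 0 = finrank F P := by
    simp only [ha]; rw [pow_zero, Module.End.one_eq_id, Submodule.map_id]
  have hb0 : b 0 = finrank F Q := by
    simp only [hb]; rw [pow_zero, Module.End.one_eq_id, Submodule.map_id]
  omega

lemma d_det (h : Module.End F V) (P Q : Submodule F V) (hc : IsCompl P Q)
    (hP : ∀ x ∈ P, h x = x) (hQ : ∀ x ∈ Q, h x = -x) : LinearMap.det h = (-1) ^ finrank F Q := by
  let e := P.prodEquivOfIsCompl Q hc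
  have : h = e.toLinearMap ∘ₗ ((LinearMap.id : P →ₗ[F] P).prodMap (-LinearMap.id : Q →ₗ[F] Q)) ∘ₗ e.symm.toLinearMap := by
    ext x
    obtain ⟨⟨a, b⟩, rfl⟩ := e.surjective x
    simp [e, hP a a.2, hQ b b.2]
  rw [this, LinearMap.det_conj, LinearMap.det_prodMap, LinearMap.det_id, one_mul,
    show (-LinearMap.id : Q →ₗ[F] Q) = (-1 : F) • LinearMap.id from (neg_one_smul F _).symm, LinearMap.det_smul, LinearMap.det_id, mul_one]

/-- rank of powers of `g - g⁻¹` -/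
lemma d_rank (h2 : (2 : F) ≠ 0) (g g' : Module.End F V) (hgg : g * g' = 1) (hg'g : g' * g = 1) (k : ℕ) :
    finrank F (LinearMap.range ((g - g') ^ k)) + finrank F V =
      finrank F (LinearMap.range ((g - 1) ^ k)) + finrank F (LinearMap.range ((g + 1) ^ k)) := by
  have hk : LinearMap.ker ((g - g') ^ k) = LinearMap.ker ((g - 1) ^ k) ⊔ LinearMap.ker ((g + 1) ^ k) := by
    have hcop : IsCoprime ((X - 1 : F[X]) ^ k) ((X + 1) ^ k) := by
      apply IsCoprime.pow
      refine ⟨-C (2 : F)⁻¹, C (2 : F)⁻¹, ?_⟩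
      have : (C (2 : F)⁻¹ : F[X]) * 2 = 1 := by
        rw [show (2 : F[X]) = C 2 from rfl, ← C_mul, inv_mul_cancel₀ h2, C_1]
      linear_combination this
    have h := sup_ker_aeval_eq_ker_aeval_mul_of_coprime g hcop
    rw [← mul_pow] at h
    simp only [map_pow, map_mul, map_sub, map_add, aeval_X, map_one] at h
    rw [h]
    have e : (g - g') ^ k = g' ^ k * ((g - 1) * (g + 1)) ^ k := by
      have hc1 : Commute g' g := by rw [Commute, SemiconjBy, hgg, hg'g]
      rw [← Commute.mul_pow]
      · congr 1
        have : (g - 1) * (g + 1) = g * g - 1 := by noncomm_ring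
        rw [this, mul_sub, ← mul_assoc, hg'g]; simp
      · exact (hc1.sub_right (Commute.one_right _)).mul_right (hc1.add_right (Commute.one_right _))
    have e' : g ^ k * g' ^ k = 1 := by
      have hc1 : Commute g g' := by rw [Commute, SemiconjBy, hgg, hg'g]
      rw [← hc1.mul_pow, hgg, one_pow]
    ext x
    rw [LinearMap.mem_ker, LinearMap.mem_ker, e, Module.End.mul_apply]
    constructor
    · intro hx
      have := congrArg (g ^ k) hx
      rw [map_zero, ← Module.End.mul_apply, e'] at this
      exact this
    · intro hx; rw [hx, map_zero]
  have hdis : Disjoint (LinearMap.ker ((g - 1) ^ k)) (LinearMap.ker ((g + 1) ^ k)) := by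
    have hcop : IsCoprime ((X - 1 : F[X]) ^ k) ((X + 1) ^ k) := by
      apply IsCoprime.pow
      refine ⟨-C (2 : F)⁻¹, C (2 : F)⁻¹, ?_⟩
      have : (C (2 : F)⁻¹ : F[X]) * 2 = 1 := by
        rw [show (2 : F[X]) = C 2 from rfl, ← C_mul, inv_mul_cancel₀ h2, C_1]
      linear_combination this
    have h := disjoint_ker_aeval_of_isCoprime g hcop
    simpa only [map_pow, map_sub, map_add, aeval_X, map_one] using h
  have h3 := Submodule.finrank_sup_add_finrank_inf_eq (LinearMap.ker ((g - 1) ^ k)) (LinearMap.ker ((g + 1) ^ k))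
  rw [hdis.eq_bot, finrank_bot, add_zero, ← hk] at h3
  have r1 := LinearMap.finrank_range_add_finrank_ker ((g - g') ^ k)
  have r2 := LinearMap.finrank_range_add_finrank_ker ((g - 1) ^ k)
  have r3 := LinearMap.finrank_range_add_finrank_ker ((g + 1) ^ k)
  omega

end Dimension

/-- Wonenburger refinement: if `g` in a finite orthogonal group (odd `q`) has no
elementary divisor `(t ∓ 1)^k` with `k` odd (encoded via ranks of powers of
`g − ε·1` for `ε = ±1`), then `n` is even and `g` is inverted by an involution in
the orthogonal group of determinant `(−1)^{n/2}`. -/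
theorem stmt_15 (p e q n : ℕ) (hp : p.Prime) (he : 0 < e) (hq : q = p ^ e)
    (hodd : Odd q) (F : Type*) [Field F] [Fintype F] (hcard : Fintype.card F = q)
    (η : Matrix (Fin n) (Fin n) F) (hsym : η.transpose = η) (hηdet : IsUnit η.det)
    (g : Matrix.GeneralLinearGroup (Fin n) F)
    (hg : (↑g : Matrix (Fin n) (Fin n) F).transpose * η *
      (↑g : Matrix (Fin n) (Fin n) F) = η)
    (hnoodd : ∀ ε : F, (ε = 1 ∨ ε = -1) → ∀ k : ℕ, Odd k →
      (((↑g : Matrix (Fin n) (Fin n) F) - ε • 1) ^ (k - 1)).rank +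
          (((↑g : Matrix (Fin n) (Fin n) F) - ε • 1) ^ (k + 1)).rank =
        2 * (((↑g : Matrix (Fin n) (Fin n) F) - ε • 1) ^ k).rank) :
    Even n ∧ ∃ h : Matrix.GeneralLinearGroup (Fin n) F,
      (↑h : Matrix (Fin n) (Fin n) F).transpose * η *
        (↑h : Matrix (Fin n) (Fin n) F) = η ∧
      h * h = 1 ∧ h * g * h⁻¹ = g⁻¹ ∧
      Matrix.det (↑h : Matrix (Fin n) (Fin n) F) = (-1 : F) ^ (n / 2) := by
  have h2 : (2 : F) ≠ 0 := by
    intro h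
    have h1 : ringChar F ∣ 2 := ringChar.dvd (by exact_mod_cast h)
    have h3 : ringChar F = 2 := by
      rcases (Nat.dvd_prime Nat.prime_two).1 h1 with h | h
      · exact absurd h (CharP.ringChar_ne_one)
      · exact h
    have h4 := FiniteField.even_card_iff_char_two.1 h3
    rw [hcard] at h4
    rw [Nat.odd_iff] at hodd
    omega
  set G : Matrix (Fin n) (Fin n) F := ↑g with hG
  set G' : Matrix (Fin n) (Fin n) F := ↑g⁻¹ with hG'
  have hGG' : G * G' = 1 := by rw [hG, hG', ← Units.val_mul, mul_inv_cancel]; rfl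
  have hG'G : G' * G = 1 := by rw [hG, hG', ← Units.val_mul, inv_mul_cancel]; rfl
  let φ := Matrix.toLinAlgEquiv' (R := F) (n := Fin n)
  let B : LinearMap.BilinForm F (Fin n → F) := Matrix.toBilin' η
  have hcomp : ∀ M : Matrix (Fin n) (Fin n) F, M.transpose * η * M = η ↔
      ∀ x y, B (φ M x) (φ M y) = B x y := by
    intro M
    rw [← (Matrix.toBilin' (R₁ := F) (n := Fin n)).injective.eq_iff, ← Matrix.toBilin'_comp]
    constructor
    · intro h x y
      exact congrArg (fun f : LinearMap.BilinForm F (Fin n → F) => f x y) h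
    · intro h
      ext x y
      exact h _ _
  have hs : ∀ x y, B x y = B y x := by
    intro x y
    simp only [B, Matrix.toBilin'_apply']
    rw [Matrix.dotProduct_mulVec, ← Matrix.mulVec_transpose, hsym, dotProduct_comm]
  have hB : ∀ x, (∀ y, B x y = 0) → x = 0 := by
    intro x h
    have h1 : η.mulVec x = 0 := by
      rw [← dotProduct_eq_zero_iff]
      intro y
      have := h y
      rw [hs] at this
      simp only [B, Matrix.toBilin'_apply'] at this
      rw [dotProduct_comm]; exact this
    have := congrArg (η⁻¹).mulVec h1
    rwa [Matrix.mulVec_mulVec, Matrix.nonsing_inv_mul _ hηdet, Matrix.one_mulVec, Matrix.mulVec_zero] at this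
  obtain ⟨h, hh, hb, hi⟩ := w_main h2 B hs hB (φ G) ((hcomp G).1 hg)
  have hh' : h * h = 1 := LinearMap.ext hh
  have hi' : h * φ G * h * φ G = 1 := LinearMap.ext hi
  have hGG : φ G * φ G' = 1 := by rw [← map_mul, hGG', map_one]
  have hGG2 : φ G' * φ G = 1 := by rw [← map_mul, hG'G, map_one]
  have hconj : h * φ G * h = φ G' := by
    calc h * φ G * h = h * φ G * h * (φ G * φ G') := by rw [hGG, mul_one]
      _ = _ := by rw [← mul_assoc, hi', one_mul]
  have hhG : h * φ G = φ G' * h := by rw [← hconj, mul_assoc (h * φ G), hh', mul_one]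
  have hhG' : h * φ G' = φ G * h := by
    rw [← hconj, ← mul_assoc, ← mul_assoc, hh', one_mul]
  set A := φ G - φ G' with hA
  have hhA : ∀ x, h (A x) = - A (h x) := by
    have : h * A = - (A * h) := by rw [hA, mul_sub, sub_mul, hhG, hhG', neg_sub]
    intro x; exact congrArg (fun f : Module.End F (Fin n → F) => f x) this
  let P := LinearMap.ker (h - 1)
  let Q := LinearMap.ker (h + 1)
  have mP : ∀ x, x ∈ P ↔ h x = x := fun x => by simp [P, sub_eq_zero]
  have mQ : ∀ x, x ∈ Q ↔ h x = -x := fun x => by simp [Q, add_eq_zero_iff_eq_neg]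
  have hc : IsCompl P Q := by
    constructor
    · rw [Submodule.disjoint_def]
      intro x hx hx'
      rw [mP] at hx
      rw [mQ, hx, eq_neg_iff_add_eq_zero, ← two_smul F] at hx'
      exact (smul_eq_zero.1 hx').resolve_left h2
    · rw [codisjoint_iff, eq_top_iff]
      intro x _
      refine Submodule.mem_sup.2 ⟨(2 : F)⁻¹ • (x + h x), ?_, (2 : F)⁻¹ • (x - h x), ?_, ?_⟩
      · rw [mP, map_smul, map_add, hh, add_comm]
      · rw [mQ, map_smul, map_sub, hh, ← smul_neg, neg_sub]
      · rw [← smul_add, show x + h x + (x - h x) = (2 : F) • x by rw [two_smul]; abel, smul_smul,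
          inv_mul_cancel₀ h2, one_smul]
  have hPA : P.map A ≤ Q := by
    rintro _ ⟨x, hx, rfl⟩
    rw [mQ, hhA, (mP x).1 hx]
  have hQA : Q.map A ≤ P := by
    rintro _ ⟨x, hx, rfl⟩
    rw [mP, hhA, (mQ x).1 hx, map_neg, neg_neg]
  have hrk : ∀ (M : Matrix (Fin n) (Fin n) F), M.rank = Module.finrank F (LinearMap.range (φ M)) := fun M => rfl
  have hdim : Module.finrank F P = Module.finrank F Q := by
    refine d_main A P Q hc hPA hQA ?_
    intro k hk
    have t0 := d_rank h2 _ _ hGG hGG2 k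
    have t1 := d_rank h2 _ _ hGG hGG2 (k + 1)
    have t2 := d_rank h2 _ _ hGG hGG2 (k + 2)
    have u1 := hnoodd 1 (Or.inl rfl) (k + 1) hk.add_one
    have u2 := hnoodd (-1) (Or.inr rfl) (k + 1) hk.add_one
    rw [← hA] at t0 t1 t2
    have r1 : ∀ k, ((G - (1 : F) • 1) ^ k).rank = Module.finrank F (LinearMap.range ((φ G - 1) ^ k)) := by
      intro k
      rw [hrk, map_pow, map_sub, one_smul, map_one]
    have r2 : ∀ k, ((G - (-1 : F) • 1) ^ k).rank = Module.finrank F (LinearMap.range ((φ G + 1) ^ k)) := by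
      intro k
      rw [hrk, map_pow, neg_smul, one_smul, sub_neg_eq_add, map_add, map_one]
    simp only [r1, r2, Nat.add_sub_cancel, show k + 1 + 1 = k + 2 from rfl] at u1 u2
    omega
  have hn : Module.finrank F P + Module.finrank F Q = n := by
    rw [Submodule.finrank_add_eq_of_isCompl hc]; simp
  have hdet := d_det h P Q hc (fun x => (mP x).1) (fun x => (mQ x).1)
  refine ⟨⟨Module.finrank F Q, by omega⟩, ?_⟩
  have hφ : φ (φ.symm h) = h := φ.apply_symm_apply h
  have hHH : φ.symm h * φ.symm h = 1 := by rw [← map_mul, hh', map_one]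
  let H : Matrix.GeneralLinearGroup (Fin n) F := ⟨φ.symm h, φ.symm h, hHH, hHH⟩
  have hHH' : H * H = 1 := Units.ext hHH
  refine ⟨H, ?_, hHH', ?_, ?_⟩
  · exact (hcomp (φ.symm h)).2 (by rw [hφ]; exact hb)
  · rw [inv_eq_of_mul_eq_one_right hHH']
    apply eq_inv_of_mul_eq_one_left
    apply Units.ext
    apply φ.injective
    change φ (φ.symm h * G * φ.symm h * G) = φ 1
    rw [map_mul, map_mul, map_mul, hφ, hi', map_one]
  · change Matrix.det (φ.symm h) = _
    have : Matrix.det (φ.symm h) = LinearMap.det h := by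
      conv_rhs => rw [← hφ]
      exact (LinearMap.det_toLin' _).symm
    rw [this, hdet]
    congr 1
    omega
end

section
/- Let q be an odd prime power and g ∈ O(V) a finite orthogonal group element possessing an elementary divisor (t−1)^k or (t+1)^k with k odd. Then there exist involutions h, h' ∈ O(V) both inverting g with det(h) = 1 and det(h') = −1. In particular, g is strongly real in SO(V). -/
namespace S16
open Polynomial Module

section basic
variable {F : Type*} [Field F] {V : Type*} [AddCommGroup V] [Module F V]

structure Ctx (B : LinearMap.BilinForm F V) (G G' : End F V) : Prop where
  symm : ∀ x y, B x y = B y x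
  nd : ∀ x, (∀ y, B x y = 0) → x = 0
  gg' : ∀ x, G (G' x) = x
  g'g : ∀ x, G' (G x) = x
  adj : ∀ x y, B (G x) y = B x (G' y)

structure Pair (B : LinearMap.BilinForm F V) (G G' : End F V) (P M : Submodule F V) : Prop where
  orth : ∀ p ∈ P, ∀ m ∈ M, B p m = 0
  sP : ∀ p ∈ P, (G + G') p ∈ P
  sM : ∀ p ∈ M, (G + G') p ∈ M
  aP : ∀ p ∈ P, (G - G') p ∈ M
  aM : ∀ p ∈ M, (G - G') p ∈ P

/-- nondegenerate on a subspace -/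
def ND (B : LinearMap.BilinForm F V) (Q : Submodule F V) : Prop :=
  ∀ x ∈ Q, (∀ y ∈ Q, B x y = 0) → x = 0

noncomputable def E (s : End F V) (v : V) : Submodule F V :=
  LinearMap.range ((LinearMap.applyₗ v) ∘ₗ (aeval (R := F) s).toLinearMap)

theorem mem_E {s : End F V} {v x : V} : x ∈ E s v ↔ ∃ f : F[X], aeval s f v = x := by
  simp [E]

theorem self_mem_E (s : End F V) (v : V) : v ∈ E s v := mem_E.2 ⟨1, by simp⟩

theorem E_zero (s : End F V) : E s 0 = ⊥ := by
  rw [eq_bot_iff]; intro x hx; obtain ⟨f, rfl⟩ := mem_E.1 hx; simp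

theorem E_stable {s : End F V} {v x : V} (hx : x ∈ E s v) : s x ∈ E s v := by
  obtain ⟨f, rfl⟩ := mem_E.1 hx
  exact mem_E.2 ⟨X * f, by simp⟩

theorem E_stable_aeval {s : End F V} {v x : V} (f : F[X]) (hx : x ∈ E s v) :
    aeval s f x ∈ E s v := by
  obtain ⟨f', rfl⟩ := mem_E.1 hx
  exact mem_E.2 ⟨f * f', by simp⟩

theorem E_le {s : End F V} {v : V} {Q : Submodule F V} (hv : v ∈ Q) (hs : ∀ x ∈ Q, s x ∈ Q) :
    E s v ≤ Q := by
  intro x hx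
  obtain ⟨f, rfl⟩ := mem_E.1 hx
  clear hx
  induction f using Polynomial.induction_on' with
  | add p q hp hq => simpa using Q.add_mem hp hq
  | monomial n c =>
    have : ∀ n, (s ^ n) v ∈ Q := by
      intro n
      induction n with
      | zero => simpa
      | succ n ih => rw [pow_succ']; exact hs _ ih
    simpa [aeval_monomial] using Q.smul_mem c (this n)

theorem adj_pow {B : LinearMap.BilinForm F V} {T T' : End F V} (h : ∀ x y, B (T x) y = B x (T' y))
    (n : ℕ) : ∀ x y, B ((T ^ n) x) y = B x ((T' ^ n) y) := by
  induction n with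
  | zero => simp
  | succ n ih => intro x y; rw [pow_succ', pow_succ]; simp [h, ih]

theorem adj_aeval {B : LinearMap.BilinForm F V} {T T' : End F V}
    (h : ∀ x y, B (T x) y = B x (T' y))
    (f : F[X]) : ∀ x y, B (aeval T f x) y = B x (aeval T' f y) := by
  intro x y
  induction f using Polynomial.induction_on' with
  | add p q hp hq => simp [hp, hq]
  | monomial n c => simp [aeval_monomial, adj_pow h]

variable {B : LinearMap.BilinForm F V} {G G' : End F V}

namespace Ctx
variable (c : Ctx B G G')
include c

theorem adj' (x y : V) : B (G' x) y = B x (G y) := by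
  rw [c.symm, ← c.adj, c.symm]

theorem s_adj (x y : V) : B ((G + G') x) y = B x ((G + G') y) := by
  simp [c.adj, c.adj']; ring

theorem a_adj (x y : V) : B ((G - G') x) y = - B x ((G - G') y) := by
  simp [c.adj, c.adj']

theorem sa (x : V) : (G + G') ((G - G') x) = (G - G') ((G + G') x) := by
  simp [c.gg', c.g'g]; abel

theorem sa_comm : Commute (G + G') (G - G') := by
  ext x; simpa using c.sa x

theorem fa (f : F[X]) (x : V) :
    aeval (G + G') f ((G - G') x) = (G - G') (aeval (G + G') f x) := by
  have : Commute (aeval (G + G') f) (G - G') := by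
    rw [commute_iff_eq]
    exact (Algebra.commute_of_mem_adjoin_singleton_of_commute (R := F)
      (aeval_mem_adjoin_singleton F (G + G')) c.sa_comm.symm).symm.eq
  exact LinearMap.congr_fun this.eq x

theorem aa (x : V) : (G - G') ((G - G') x) = aeval (G + G') (X ^ 2 - 4 : F[X]) x := by
  have h4 : (4 : F[X]) = C 4 := (map_ofNat C 4).symm
  rw [h4]
  simp [c.gg', c.g'g, pow_two, algebraMap_end_apply]
  have : (4 : F) • x = x + x + x + x := by
    rw [show (4 : F) = 1 + 1 + 1 + 1 by norm_num]; simp [add_smul]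
  rw [this]; abel

theorem f_adj (f : F[X]) (x y : V) :
    B (aeval (G + G') f x) y = B x (aeval (G + G') f y) := adj_aeval c.s_adj f x y

theorem faf (h2 : (2 : F) ≠ 0) (f h : F[X]) (v : V) :
    B (aeval (G + G') f v) ((G - G') (aeval (G + G') h v)) = 0 := by
  have e1 : B (aeval (G + G') f v) ((G - G') (aeval (G + G') h v)) =
      B v ((G - G') (aeval (G + G') (f * h) v)) := by
    rw [c.f_adj, c.fa]; simp
  have e : B v ((G - G') (aeval (G + G') (f * h) v)) =
      - B v ((G - G') (aeval (G + G') (f * h) v)) := by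
    conv_lhs => rw [c.symm, c.a_adj, c.f_adj, c.fa]
  rw [e1]
  have : 2 * B v ((G - G') (aeval (G + G') (f * h) v)) = 0 := by linear_combination e
  simpa [h2] using this

end Ctx
end basic
end S16

namespace S16
open Polynomial Module
section p2
variable {F : Type*} [Field F] {V : Type*} [AddCommGroup V] [Module F V]
variable {B : LinearMap.BilinForm F V} {G G' : End F V}

theorem pairEW (c : Ctx B G G') (h2 : (2 : F) ≠ 0) {v w : V}
    (hvw : ∀ f : F[X], B (aeval (G + G') f v) w = 0) :
    Pair B G G' (E (G + G') v ⊔ (E (G + G') w).map (G - G'))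
      ((E (G + G') v).map (G - G') ⊔ E (G + G') w) := by
  have hvw' : ∀ f h : F[X], B (aeval (G + G') f v) (aeval (G + G') h w) = 0 := by
    intro f h
    rw [← c.f_adj]
    simpa using hvw (h * f)
  have hE : ∀ {v x : V}, x ∈ E (G + G') v → (G - G') ((G - G') x) ∈ E (G + G') v := by
    intro v x hx
    rw [c.aa]; exact E_stable_aeval _ hx
  have key : ∀ v w : V, ∀ p ∈ E (G + G') v ⊔ (E (G + G') w).map (G - G'),
      (G + G') p ∈ E (G + G') v ⊔ (E (G + G') w).map (G - G') ∧
      (G - G') p ∈ (E (G + G') v).map (G - G') ⊔ E (G + G') w := by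
    intro v w p hp
    obtain ⟨x, hx, y, hy, rfl⟩ := Submodule.mem_sup.1 hp
    obtain ⟨y, hy, rfl⟩ := hy
    rw [map_add, map_add]
    refine ⟨Submodule.add_mem_sup (E_stable hx) ?_, Submodule.add_mem_sup ?_ (hE hy)⟩
    · rw [c.sa]; exact Submodule.mem_map_of_mem (E_stable hy)
    · exact Submodule.mem_map_of_mem hx
  refine ⟨?_, fun p hp => (key v w p hp).1, ?_, fun p hp => (key v w p hp).2, ?_⟩
  · intro p hp m hm
    obtain ⟨x, hx, y, hy, rfl⟩ := Submodule.mem_sup.1 hp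
    obtain ⟨y, hy, rfl⟩ := hy
    obtain ⟨x', hx', y', hy', rfl⟩ := Submodule.mem_sup.1 hm
    obtain ⟨x', hx', rfl⟩ := hx'
    obtain ⟨f, rfl⟩ := mem_E.1 hx
    obtain ⟨f', rfl⟩ := mem_E.1 hx'
    obtain ⟨h, rfl⟩ := mem_E.1 hy
    obtain ⟨h', rfl⟩ := mem_E.1 hy'
    rw [map_add, map_add, LinearMap.add_apply, LinearMap.add_apply, c.faf h2, hvw',
      c.a_adj, c.aa, c.symm ((G - G') _), c.faf h2, c.symm, ← Module.End.mul_apply, ← map_mul, hvw']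
    simp
  · intro p hp
    rw [sup_comm] at hp ⊢
    exact (key w v p hp).1
  · intro p hp
    rw [sup_comm] at hp ⊢
    exact (key w v p hp).2

theorem Pair.swap (c : Ctx B G G') {P M : Submodule F V} (h : Pair B G G' P M) :
    Pair B G G' M P :=
  ⟨fun p hp m hm => by rw [c.symm]; exact h.orth m hm p hp, h.sM, h.sP, h.aM, h.aP⟩

theorem stable_of_sa (h2 : (2 : F) ≠ 0) {Q : Submodule F V} {x : V} (hs : (G + G') x ∈ Q)
    (ha : (G - G') x ∈ Q) : G x ∈ Q ∧ G' x ∈ Q := by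
  have e1 : G x = (2 : F)⁻¹ • ((G + G') x + (G - G') x) := by
    simp only [LinearMap.add_apply, LinearMap.sub_apply]
    rw [show G x + G' x + (G x - G' x) = (2 : F) • G x by rw [two_smul]; abel, smul_smul,
      inv_mul_cancel₀ h2, one_smul]
  have e2 : G' x = (2 : F)⁻¹ • ((G + G') x - (G - G') x) := by
    simp only [LinearMap.add_apply, LinearMap.sub_apply]
    rw [show G x + G' x - (G x - G' x) = (2 : F) • G' x by rw [two_smul]; abel, smul_smul,
      inv_mul_cancel₀ h2, one_smul]
  exact ⟨e1 ▸ Q.smul_mem _ (Q.add_mem hs ha), e2 ▸ Q.smul_mem _ (Q.sub_mem hs ha)⟩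

theorem Pair.stable (h2 : (2 : F) ≠ 0) {P M : Submodule F V} (h : Pair B G G' P M) {x : V}
    (hx : x ∈ P ⊔ M) : G x ∈ P ⊔ M ∧ G' x ∈ P ⊔ M := by
  obtain ⟨p, hp, m, hm, rfl⟩ := Submodule.mem_sup.1 hx
  apply stable_of_sa h2
  · rw [map_add]; exact Submodule.add_mem_sup (h.sP p hp) (h.sM m hm)
  · rw [map_add, add_comm]; exact Submodule.add_mem_sup (h.aM m hm) (h.aP p hp)

theorem Pair.sup {P M P' M' : Submodule F V} (h : Pair B G G' P M) (h' : Pair B G G' P' M')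
    (h1 : ∀ x ∈ P, ∀ y ∈ M', B x y = 0) (h3 : ∀ x ∈ P', ∀ y ∈ M, B x y = 0) :
    Pair B G G' (P ⊔ P') (M ⊔ M') := by
  refine ⟨?_, ?_, ?_, ?_, ?_⟩
  · intro p hp m hm
    obtain ⟨x, hx, y, hy, rfl⟩ := Submodule.mem_sup.1 hp
    obtain ⟨x', hx', y', hy', rfl⟩ := Submodule.mem_sup.1 hm
    simp [h.orth x hx x' hx', h'.orth y hy y' hy', h1 x hx y' hy', h3 y hy x' hx']
  all_goals
    intro p hp
    obtain ⟨x, hx, y, hy, rfl⟩ := Submodule.mem_sup.1 hp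
    rw [map_add]
  · exact Submodule.add_mem_sup (h.sP _ hx) (h'.sP _ hy)
  · exact Submodule.add_mem_sup (h.sM _ hx) (h'.sM _ hy)
  · exact Submodule.add_mem_sup (h.aP _ hx) (h'.aP _ hy)
  · exact Submodule.add_mem_sup (h.aM _ hx) (h'.aM _ hy)

/-- separation -/
theorem Ctx.sep [FiniteDimensional F V] (c : Ctx B G G') {S : Submodule F V} {z : V} (hz : z ∉ S) :
    ∃ w, (∀ x ∈ S, B x w = 0) ∧ B z w ≠ 0 := by
  have hnd : LinearMap.BilinForm.Nondegenerate B :=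
    ⟨fun x hx => c.nd x hx, fun x hx => c.nd x (fun y => by rw [c.symm]; exact hx y)⟩
  obtain ⟨φ, h1, h3⟩ := Submodule.exists_le_ker_of_notMem hz
  refine ⟨(B.toDual hnd).symm φ, fun x hx => ?_, ?_⟩
  · rw [c.symm, LinearMap.BilinForm.apply_toDual_symm_apply]; exact h3 hx
  · rw [c.symm, LinearMap.BilinForm.apply_toDual_symm_apply]; exact h1

theorem Pair.disjoint (c : Ctx B G G') {P M : Submodule F V} (h : Pair B G G' P M)
    (hQ : ND B (P ⊔ M)) : Disjoint P M := by
  rw [Submodule.disjoint_def]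
  intro x hx hx'
  apply hQ x (Submodule.mem_sup_left hx)
  intro y hy
  obtain ⟨p, hp, m, hm, rfl⟩ := Submodule.mem_sup.1 hy
  rw [map_add, h.orth x hx m hm, c.symm, h.orth p hp x hx', add_zero]

/-- The involution attached to a pair. -/
theorem Pair.invol [FiniteDimensional F V] (c : Ctx B G G') (h2 : (2 : F) ≠ 0)
    {P M : Submodule F V}
    (h : Pair B G G' P M) (hT : P ⊔ M = ⊤) : ∃ t : End F V, t * t = 1 ∧
      (∀ x y, B (t x) (t y) = B x y) ∧ t * G * t = G' ∧
      LinearMap.det t = (-1) ^ (finrank F M) := by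
  have hd : Disjoint P M := h.disjoint c (fun x _ hx => c.nd x (fun y => hx y (hT ▸ trivial)))
  have hc : IsCompl P M := ⟨hd, codisjoint_iff.2 hT⟩
  let e := Submodule.prodEquivOfIsCompl P M hc
  let t : End F V := e.toLinearMap ∘ₗ (LinearMap.prodMap LinearMap.id (-LinearMap.id)) ∘ₗ
    e.symm.toLinearMap
  have tP : ∀ p ∈ P, t p = p := by
    intro p hp
    have : e.symm p = (⟨p, hp⟩, 0) := by
      rw [LinearEquiv.symm_apply_eq]; simp [e]
    simp [t, this]; simp [e]
  have tM : ∀ p ∈ M, t p = -p := by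
    intro p hp
    have : e.symm p = (0, ⟨p, hp⟩) := by
      rw [LinearEquiv.symm_apply_eq]; simp [e]
    simp [t, this]; simp [e]
  have ex : ∀ x : V, ∃ p ∈ P, ∃ m ∈ M, p + m = x := fun x =>
    Submodule.mem_sup.1 (hT ▸ (trivial : x ∈ (⊤ : Submodule F V)))
  refine ⟨t, ?_, ?_, ?_, ?_⟩
  · ext x
    obtain ⟨p, hp, m, hm, rfl⟩ := ex x
    simp [tP p hp, tM m hm]
  · intro x y
    obtain ⟨p, hp, m, hm, rfl⟩ := ex x
    obtain ⟨p', hp', m', hm', rfl⟩ := ex y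
    simp [tP p hp, tM m hm, tP p' hp', tM m' hm', h.orth p hp m' hm', c.symm m p',
      h.orth p' hp' m hm]
  · ext x
    obtain ⟨p, hp, m, hm, rfl⟩ := ex x
    have hG : ∀ x, G x = (2 : F)⁻¹ • ((G + G') x + (G - G') x) := fun x => by
      simp only [LinearMap.add_apply, LinearMap.sub_apply]
      rw [show G x + G' x + (G x - G' x) = (2 : F) • G x by rw [two_smul]; abel, smul_smul,
        inv_mul_cancel₀ h2, one_smul]
    have hG' : ∀ x, G' x = (2 : F)⁻¹ • ((G + G') x - (G - G') x) := fun x => by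
      simp only [LinearMap.add_apply, LinearMap.sub_apply]
      rw [show G x + G' x - (G x - G' x) = (2 : F) • G' x by rw [two_smul]; abel, smul_smul,
        inv_mul_cancel₀ h2, one_smul]
    have e1 : t (G p) = G' p := by
      rw [hG, hG', map_smul, map_add, tP _ (h.sP p hp), tM _ (h.aP p hp), ← sub_eq_add_neg]
    have e2 : t (G m) = - G' m := by
      rw [hG, hG', map_smul, map_add, tM _ (h.sM m hm), tP _ (h.aM m hm), ← smul_neg]
      congr 1; abel
    simp [tP p hp, tM m hm, e1, e2]
  · have : LinearMap.det t = _ := LinearMap.det_conj _ e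
    rw [this, LinearMap.det_prodMap, ← neg_one_smul F LinearMap.id, LinearMap.det_smul]
    simp

end p2
end S16

namespace S16
open Polynomial Module
section p3
variable {F : Type*} [Field F] {V : Type*} [AddCommGroup V] [Module F V]
variable {B : LinearMap.BilinForm F V} {G G' : End F V}

theorem Ctx.stable' [FiniteDimensional F V] (c : Ctx B G G') {Q : Submodule F V}
    (h : ∀ x ∈ Q, G x ∈ Q) : ∀ x ∈ Q, G' x ∈ Q := by
  have hinj : Function.Injective G := fun x y hxy => by
    rw [← c.g'g x, hxy, c.g'g]
  have hle : Q.map G ≤ Q := by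
    rintro _ ⟨x, hx, rfl⟩; exact h x hx
  have : Q.map G = Q := Submodule.eq_of_le_of_finrank_eq hle
    (Submodule.equivMapOfInjective G hinj Q).finrank_eq.symm
  intro x hx
  rw [← this] at hx
  obtain ⟨y, hy, rfl⟩ := hx
  rwa [c.g'g]

theorem Ctx.N_adj (c : Ctx B G G') (ε : F) (x y : V) :
    B ((G - ε • 1) x) y = B x ((G' - ε • 1) y) := by
  simp [c.adj]

theorem Ctx.N'_pow (c : Ctx B G G') {ε : F} (hε : ε * ε = 1) (n : ℕ) (y : V) :
    ((G' - ε • 1) ^ n) y = (-ε) ^ n • (G' ^ n) (((G - ε • 1) ^ n) y) := by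
  have h1 : (G' - ε • 1 : End F V) = (-ε) • (G' * (G - ε • 1)) := by
    ext x; simp [c.g'g, smul_sub, smul_smul, hε]
  have h3 : Commute G' (G - ε • 1) := by
    rw [commute_iff_eq]; ext x; simp [c.g'g, c.gg']
  rw [h1, _root_.smul_pow, h3.mul_pow]; rfl

theorem Ctx.G'_pow_inj (c : Ctx B G G') (n : ℕ) {y : V} (h : (G' ^ n) y = 0) : y = 0 := by
  have : (G ^ n) ((G' ^ n) y) = y := by
    have hc : Commute G G' := by rw [commute_iff_eq]; ext x; simp [c.g'g, c.gg']
    have h1 : G * G' = 1 := by ext x; simp [c.gg']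
    rw [← Module.End.mul_apply, ← hc.mul_pow, h1]; simp
  rw [← this, h, map_zero]

theorem ne_of_sq {ε : F} (hε : ε * ε = 1) : ε ≠ 0 := by
  rintro rfl; simp at hε

theorem Ctx.ker_N' (c : Ctx B G G') {ε : F} (hε : ε * ε = 1) (n : ℕ) {y : V}
    (h : ((G' - ε • 1) ^ n) y = 0) : ((G - ε • 1) ^ n) y = 0 := by
  rw [c.N'_pow hε] at h
  have h' := (smul_eq_zero.1 h).resolve_left (pow_ne_zero _ (neg_ne_zero.2 (ne_of_sq hε)))
  exact c.G'_pow_inj n h'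

theorem Ctx.G'_eig (c : Ctx B G G') {ε : F} (hε : ε * ε = 1) {z : V}
    (h : (G - ε • 1 : End F V) z = 0) : G z = ε • z ∧ G' z = ε • z := by
  have h1 : G z = ε • z := by simpa [sub_eq_zero] using h
  refine ⟨h1, ?_⟩
  have := c.g'g z
  rw [h1, map_smul] at this
  conv_rhs => rw [← this, smul_smul, hε, one_smul]

theorem Ctx.N_form (c : Ctx B G G') {ε : F} (hε : ε * ε = 1) (j : ℕ) (x : V) {y : V}
    (hy : ((G - ε • 1) ^ (j + 1)) y = 0) :
    B (((G - ε • 1) ^ j) x) y = (-1) ^ j * B x (((G - ε • 1) ^ j) y) := by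
  rw [adj_pow (c.N_adj ε), c.N'_pow hε]
  have h0 := (c.G'_eig hε (z := ((G - ε • 1) ^ j) y) (by rw [pow_succ'] at hy; exact hy)).2
  have : (G' ^ j) (((G - ε • 1) ^ j) y) = ε ^ j • (((G - ε • 1) ^ j) y) := by
    generalize ((G - ε • 1) ^ j) y = z at h0
    clear hy
    induction j with
    | zero => simp
    | succ j ih => rw [pow_succ, End.mul_apply, h0, map_smul, ih, smul_smul, pow_succ']
  rw [this, smul_smul, ← mul_pow, neg_mul, hε]; simp

theorem chain (c : Ctx B G G') {ε : F} {j : ℕ} {v w : V}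
    (hv : ((G - ε • 1) ^ (j + 1)) v = 0) (hw : ((G - ε • 1) ^ (j + 1)) w = 0)
    (H : ∀ α β : F, B (α • ((G - ε • 1) ^ j) v + β • ((G - ε • 1) ^ j) w) v = 0 →
      B (α • ((G - ε • 1) ^ j) v + β • ((G - ε • 1) ^ j) w) w = 0 → α • v = 0 ∧ β • w = 0)
    {Q : Submodule F V} (hvQ : v ∈ Q) (hwQ : w ∈ Q) (hG' : ∀ x ∈ Q, G' x ∈ Q)
    (hQ : Q ≤ E (G - ε • 1) v ⊔ E (G - ε • 1) w) : ND B Q := by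
  intro x hx hxQ
  set N : End F V := G - ε • 1 with hN
  have hR : ∀ i, ∀ y ∈ Q, B ((N ^ i) x) y = 0 := by
    intro i
    induction i with
    | zero => simpa using hxQ
    | succ i ih =>
      intro y hy
      rw [pow_succ', End.mul_apply, c.N_adj]
      apply ih
      simpa using Q.sub_mem (hG' y hy) (Q.smul_mem ε hy)
  have hcl : ∀ i, i ≤ j + 1 → ∃ f f' : F[X], x = (N ^ i) (aeval N f v + aeval N f' w) := by
    intro i
    induction i with
    | zero =>
      intro _
      obtain ⟨p, hp, m, hm, rfl⟩ := Submodule.mem_sup.1 (hQ hx)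
      obtain ⟨f, rfl⟩ := mem_E.1 hp
      obtain ⟨f', rfl⟩ := mem_E.1 hm
      exact ⟨f, f', by simp⟩
    | succ i ih =>
      intro hi
      obtain ⟨f, f', hxe⟩ := ih (by omega)
      have hd : ∀ (f : F[X]) (v : V), aeval N f v = f.coeff 0 • v + N (aeval N f.divX v) := by
        intro f v
        have e := congrArg (fun p => aeval N p v) (Polynomial.X_mul_divX_add f)
        simp only [map_add, map_mul, aeval_X, aeval_C, LinearMap.add_apply, End.mul_apply,
          algebraMap_end_apply] at e
        rw [← e, add_comm]
      have hz : ∀ (f : F[X]) (v : V), (N ^ (j + 1)) v = 0 →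
          (N ^ j) (aeval N f v) = f.coeff 0 • (N ^ j) v := by
        intro f v hv
        rw [hd f v, map_add, map_smul]
        have : (N ^ j) (N (aeval N f.divX v)) = aeval N f.divX ((N ^ (j + 1)) v) := by
          rw [← End.mul_apply, ← pow_succ, ← End.mul_apply, ← End.mul_apply]
          congr 1
          have : N ^ (j + 1) = aeval N (X ^ (j + 1) : F[X]) := by simp
          rw [this, ← map_mul, ← map_mul, mul_comm]
        rw [this, hv, map_zero, add_zero]
      have hzx : (N ^ (j - i)) x = f.coeff 0 • (N ^ j) v + f'.coeff 0 • (N ^ j) w := by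
        rw [hxe, ← End.mul_apply, ← pow_add, Nat.sub_add_cancel (by omega), map_add, hz f v hv,
          hz f' w hw]
      have h1 := hR (j - i)
      rw [hzx] at h1
      obtain ⟨e1, e2⟩ := H _ _ (h1 v hvQ) (h1 w hwQ)
      refine ⟨f.divX, f'.divX, ?_⟩
      rw [hxe, hd f v, hd f' w, e1, e2, pow_succ, End.mul_apply, map_add N]
      simp
  obtain ⟨f, f', hxe⟩ := hcl (j + 1) le_rfl
  have : ∀ (f : F[X]) (v : V), (N ^ (j + 1)) v = 0 → (N ^ (j + 1)) (aeval N f v) = 0 := by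
    intro f v hv
    have : N ^ (j + 1) = aeval N (X ^ (j + 1) : F[X]) := by simp
    rw [this, ← End.mul_apply, ← map_mul, mul_comm, map_mul, ← this, End.mul_apply, hv, map_zero]
  rw [hxe, map_add, this f v hv, this f' w hw, add_zero]

/-- The space `Q` attached to `v,w` lies in the `N`-cyclic span. -/
theorem Q_le [FiniteDimensional F V] (c : Ctx B G G') (ε : F) (v w : V) :
    (E (G + G') v ⊔ (E (G + G') w).map (G - G')) ⊔ ((E (G + G') v).map (G - G') ⊔ E (G + G') w) ≤
      E (G - ε • 1) v ⊔ E (G - ε • 1) w := by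
  have hG : ∀ v x, x ∈ E (G - ε • 1) v → G x ∈ E (G - ε • 1) v := by
    intro v x hx
    have := Submodule.add_mem _ (E_stable hx) (Submodule.smul_mem _ ε hx)
    simpa using this
  have hG' := fun v => c.stable' (hG v)
  have h1 : ∀ v, E (G + G') v ≤ E (G - ε • 1) v := fun v =>
    E_le (self_mem_E _ _) (fun x hx => Submodule.add_mem _ (hG v x hx) (hG' v x hx))
  have h3 : ∀ v, (E (G + G') v).map (G - G') ≤ E (G - ε • 1) v := by
    intro v
    rintro _ ⟨x, hx, rfl⟩
    exact Submodule.sub_mem _ (hG v x (h1 v hx)) (hG' v x (h1 v hx))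
  exact sup_le (sup_le_sup (h1 v) (h3 w)) (sup_le_sup (h3 v) (h1 w))

theorem polar (h2 : (2 : F) ≠ 0) {T : End F V} {S : Submodule F V}
    (hs : ∀ x ∈ S, ∀ y ∈ S, B (T x) y = B (T y) x) {v w : V} (hv : v ∈ S) (hw : w ∈ S)
    (h : B (T v) w ≠ 0) : ∃ u ∈ S, B (T u) u ≠ 0 := by
  by_contra! hc
  apply h
  have h1 := hc (v + w) (S.add_mem hv hw)
  simp only [map_add, LinearMap.add_apply, hc v hv, hc w hw, hs w hw v hv] at h1
  have : 2 * B (T v) w = 0 := by linear_combination h1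
  simpa [h2] using this

/-- odd case: find `v` -/
theorem find_odd [FiniteDimensional F V] (c : Ctx B G G') (h2 : (2 : F) ≠ 0) {ε : F}
    (hε : ε * ε = 1)
    {j : ℕ} (hj : Even j) {z : V} (hz : (G - ε • 1 : End F V) z = 0)
    (hz1 : z ∈ LinearMap.range ((G - ε • 1 : End F V) ^ j))
    (hz2 : z ∉ LinearMap.range ((G - ε • 1 : End F V) ^ (j + 1))) :
    ∃ v, ((G - ε • 1) ^ (j + 1)) v = 0 ∧ B (((G - ε • 1) ^ j) v) v ≠ 0 := by
  obtain ⟨w, hw, hzw⟩ := c.sep hz2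
  obtain ⟨v, rfl⟩ := hz1
  have hw' : ((G - ε • 1) ^ (j + 1)) w = 0 := by
    apply c.ker_N' hε
    apply c.nd
    intro y
    rw [c.symm, ← adj_pow (c.N_adj ε)]
    exact hw _ ⟨y, rfl⟩
  have hv : ((G - ε • 1) ^ (j + 1)) v = 0 := by rw [pow_succ']; exact hz
  exact polar (S := LinearMap.ker ((G - ε • 1) ^ (j + 1))) h2
    (fun x hx y hy => by rw [c.N_form hε j x hy, hj.neg_one_pow, one_mul, c.symm]) hv hw' hzw

theorem odd_ND [FiniteDimensional F V] (c : Ctx B G G') (h2 : (2 : F) ≠ 0) {ε : F}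
    {j : ℕ} {v : V}
    (hv : ((G - ε • 1) ^ (j + 1)) v = 0) (hvv : B (((G - ε • 1) ^ j) v) v ≠ 0) :
    Pair B G G' (E (G + G') v) ((E (G + G') v).map (G - G')) ∧
    ND B (E (G + G') v ⊔ (E (G + G') v).map (G - G')) := by
  have hP := pairEW c h2 (v := v) (w := 0) (by simp)
  have hQ := Q_le c ε v 0
  simp only [E_zero, Submodule.map_bot, sup_bot_eq] at hP hQ
  refine ⟨hP, ?_⟩
  refine chain c hv (w := 0) (map_zero _) ?_ (Submodule.mem_sup_left (self_mem_E _ _))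
    (Submodule.zero_mem _) (fun x hx => (hP.stable h2 hx).2) (by simpa [E_zero] using hQ)
  intro α β h _
  simp [hvv] at h
  simp [h]

end p3
end S16

namespace S16
open Polynomial Module
section p4
variable {F : Type*} [Field F] {V : Type*} [AddCommGroup V] [Module F V]
variable {B : LinearMap.BilinForm F V} {G G' : End F V}

theorem commute_aeval {S T : End F V} (h : Commute S T) (f : F[X]) : Commute (aeval S f) T :=
  (Algebra.commute_of_mem_adjoin_singleton_of_commute (R := F)
      (aeval_mem_adjoin_singleton F S) h.symm).symm

theorem cap {S T : End F V} (h : Commute S T) (x : V) : S (T x) = T (S x) :=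
  LinearMap.congr_fun h.eq x

theorem Ctx.comm (c : Ctx B G G') : Commute G G' := by
  rw [commute_iff_eq]; ext x; simp [c.g'g, c.gg']

theorem Ctx.N_comm_s (c : Ctx B G G') (ε : F) : Commute (G + G') (G - ε • 1) :=
  (((Commute.refl G).add_left c.comm.symm).sub_right ((Commute.one_right _).smul_right ε))

theorem Ctx.N_comm_G' (c : Ctx B G G') (ε : F) : Commute G' (G - ε • 1) :=
  c.comm.symm.sub_right ((Commute.one_right _).smul_right ε)

theorem Ctx.y_pow (c : Ctx B G G') {ε : F} (hε : ε * ε = 1) (n : ℕ) (x : V) :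
    aeval (G + G') ((X - C (2 * ε)) ^ n : F[X]) x = (G' ^ n) (((G - ε • 1) ^ (2 * n)) x) := by
  have h1 : aeval (G + G') (X - C (2 * ε) : F[X]) = G' * (G - ε • 1) ^ 2 := by
    ext x
    simp [pow_two, c.g'g, smul_sub, smul_smul, hε, algebraMap_end_apply, two_mul]
    abel
  rw [map_pow, h1, ((c.N_comm_G' ε).pow_right 2).mul_pow, ← pow_mul]; rfl

theorem finrank_map_ker [FiniteDimensional F V] (f : End F V) (p : Submodule F V) :
    finrank F (p.map f) + finrank F (p ⊓ LinearMap.ker f : Submodule F V) = finrank F p := by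
  have := LinearMap.finrank_range_add_finrank_ker (f.domRestrict p)
  rw [LinearMap.range_domRestrict, LinearMap.ker_domRestrict] at this
  rw [← this, ← Submodule.map_comap_subtype, Submodule.finrank_map_subtype_eq]

theorem odd_finrank [FiniteDimensional F V] (c : Ctx B G G') (h2 : (2 : F) ≠ 0) {ε : F}
    (hε : ε * ε = 1) {j : ℕ} (hj : Even j) {v : V}
    (hv : ((G - ε • 1) ^ (j + 1)) v = 0) (hvv : B (((G - ε • 1) ^ j) v) v ≠ 0) :
    finrank F (E (G + G') v) = finrank F ((E (G + G') v).map (G - G')) + 1 := by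
  obtain ⟨hP, hND⟩ := odd_ND c h2 hv hvv
  have hQ := Q_le c ε v 0
  simp only [E_zero, Submodule.map_bot, sup_bot_eq] at hQ
  rw [← finrank_map_ker (G - G')]
  congr 1
  set z := ((G - ε • 1) ^ j) v with hz
  have hNz : (G - ε • 1 : End F V) z = 0 := by rw [pow_succ'] at hv; exact hv
  obtain ⟨gz, g'z⟩ := c.G'_eig hε hNz
  have hz0 : z ≠ 0 := by rintro h; rw [h] at hvv; simp at hvv
  have hzE : z ∈ E (G + G') v := by
    obtain ⟨m, rfl⟩ := hj
    have h1 := c.y_pow hε m v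
    rw [two_mul m, ← hz] at h1
    have h3 : ∀ m, (G' ^ m) z = ε ^ m • z := by
      intro m
      induction m with
      | zero => simp
      | succ m ih => rw [pow_succ, End.mul_apply, g'z, map_smul, ih, smul_smul, pow_succ']
    rw [h3] at h1
    refine mem_E.2 ⟨C (ε ^ m) * (X - C (2 * ε)) ^ m, ?_⟩
    rw [map_mul, End.mul_apply, h1, aeval_C, algebraMap_end_apply, smul_smul, ← mul_pow, hε,
      one_pow, one_smul]
  have : E (G + G') v ⊓ LinearMap.ker (G - G') = Submodule.span F {z} := by
    apply le_antisymm
    · rintro x ⟨hx, hxa⟩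
      have hxN := hQ (Submodule.mem_sup_left hx)
      have hax : (G - G') x = 0 := hxa
      have hK : ((G - ε • 1) ^ (j + 1)) x = 0 := by
        obtain ⟨f, rfl⟩ := mem_E.1 hx
        rw [← cap (commute_aeval ((c.N_comm_s ε).pow_right (j + 1)) f), hv, map_zero]
      have hNN : (G - ε • 1 : End F V) ((G - ε • 1 : End F V) x) =
          (-(2 * ε)) • (G - ε • 1 : End F V) x := by
        have e1 : G x = G' x := by simpa [sub_eq_zero] using hax
        have e2 : G (G x) = x := by rw [e1, c.gg']
        simp only [LinearMap.sub_apply, LinearMap.smul_apply, End.one_apply, map_sub, map_smul, e2]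
        match_scalars <;> first | ring1 | linear_combination hε | linear_combination -hε
      have hNx : (G - ε • 1 : End F V) x = 0 := by
        have : ∀ i, ((G - ε • 1 : End F V) ^ (i + 1)) x =
            (-(2 * ε)) ^ i • (G - ε • 1 : End F V) x := by
          intro i
          induction i with
          | zero => simp
          | succ i ih =>
            rw [pow_succ', End.mul_apply, ih, map_smul, hNN, smul_smul, pow_succ]
        rw [this] at hK
        exact (smul_eq_zero.1 hK).resolve_left
          (pow_ne_zero _ (neg_ne_zero.2 (mul_ne_zero h2 (ne_of_sq hε))))
      have hx0 : x - (B x v / B z v) • z = 0 := by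
        apply hND _ (Submodule.mem_sup_left (Submodule.sub_mem _ hx (Submodule.smul_mem _ _ hzE)))
        intro y hy
        obtain ⟨f, rfl⟩ := mem_E.1 (hQ hy)
        have e := congrArg (fun p => aeval (G - ε • 1 : End F V) p v) (Polynomial.X_mul_divX_add f)
        simp only [map_add, map_mul, aeval_X, aeval_C, LinearMap.add_apply, End.mul_apply,
          algebraMap_end_apply] at e
        rw [← e]
        have hN' : (G' - ε • 1 : End F V) (x - (B x v / B z v) • z) = 0 := by
          have := c.N'_pow hε 1 (x - (B x v / B z v) • z)
          rw [pow_one, pow_one, pow_one, pow_one, map_sub (G - ε • 1), map_smul (G - ε • 1), hNx,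
            hNz] at this
          rw [this]; simp
        rw [map_add, c.symm _ ((G - ε • 1 : End F V) _), c.N_adj, hN', map_zero, map_smul, map_sub,
          LinearMap.sub_apply, map_smul, LinearMap.smul_apply, smul_eq_mul, smul_eq_mul,
          div_mul_cancel₀ _ hvv]
        simp
      rw [sub_eq_zero] at hx0
      rw [hx0]
      exact Submodule.smul_mem _ _ (Submodule.mem_span_singleton_self z)
    · rw [Submodule.span_singleton_le_iff_mem]
      exact ⟨hzE, by simp [gz, g'z]⟩
  rw [this, finrank_span_singleton hz0]

theorem even_case [FiniteDimensional F V] (c : Ctx B G G') (h2 : (2 : F) ≠ 0) {ε : F}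
    (hε : ε * ε = 1) {j : ℕ} (hj : Odd j) {z : V} (hz0 : z ≠ 0)
    (hNz : (G - ε • 1 : End F V) z = 0)
    (hz1 : z ∈ LinearMap.range ((G - ε • 1 : End F V) ^ j))
    (hd : ∀ x, (G - ε • 1 : End F V) x = 0 →
      x ∈ LinearMap.range ((G - ε • 1 : End F V) ^ (j + 1)) → x = 0) :
    ∃ P M, Pair B G G' P M ∧ ND B (P ⊔ M) ∧ P ⊔ M ≠ ⊥ := by
  obtain ⟨v, hvz⟩ := hz1
  have hv : ((G - ε • 1) ^ (j + 1)) v = 0 := by rw [pow_succ', End.mul_apply, hvz, hNz]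
  have hd' : ∀ i x, ((G - ε • 1 : End F V) ^ i) x = 0 →
      x ∈ LinearMap.range ((G - ε • 1 : End F V) ^ (j + 1)) → x = 0 := by
    intro i
    induction i with
    | zero => intro x hx _; simpa using hx
    | succ i ih =>
      intro x hx hxr
      apply hd x _ hxr
      apply ih
      · rw [pow_succ] at hx; exact hx
      · obtain ⟨y, rfl⟩ := hxr
        refine ⟨(G - ε • 1 : End F V) y, ?_⟩
        rw [← End.mul_apply, ← End.mul_apply, ← pow_succ, ← pow_succ']
  obtain ⟨gz, g'z⟩ := c.G'_eig hε hNz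
  have hzS : z ∉ E (G + G') v ⊔ LinearMap.range ((G - ε • 1 : End F V) ^ (j + 1)) := by
    intro hmem
    obtain ⟨x, hx, r, hr, hxr⟩ := Submodule.mem_sup.1 hmem
    obtain ⟨f, rfl⟩ := mem_E.1 hx
    have hNf : ∀ (n : ℕ) (f : F[X]) (x : V), ((G - ε • 1 : End F V) ^ n) (aeval (G + G') f x) =
        aeval (G + G') f (((G - ε • 1 : End F V) ^ n) x) := fun n f x =>
      (cap (commute_aeval ((c.N_comm_s ε).pow_right n) f) x).symm
    have hr0 : r = 0 := by
      apply hd' (j + 1) r _ hr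
      rw [eq_sub_of_add_eq' hxr, map_sub, hNf, hv, pow_succ, End.mul_apply, hNz]
      simp
    rw [hr0, add_zero] at hxr
    have hf0 : f ≠ 0 := by rintro rfl; apply hz0; rw [← hxr]; simp
    obtain ⟨f1, hf1, hnd⟩ := f.exists_eq_pow_rootMultiplicity_mul_and_not_dvd hf0 (2 * ε)
    set i := rootMultiplicity (2 * ε) f
    have hxr' : z = (G' ^ i) (((G - ε • 1 : End F V) ^ (2 * i)) (aeval (G + G') f1 v)) := by
      rw [← c.y_pow hε, ← hxr, hf1, map_mul, End.mul_apply]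
    rcases le_or_gt (j + 1) (2 * i) with hij | hij
    · apply hz0
      rw [hxr', hNf, ← Nat.sub_add_cancel hij, pow_add, End.mul_apply, hv]
      simp
    · obtain ⟨m, hm⟩ := hj
      have hpos : j - 2 * i = (j - 2 * i - 1) + 1 := by omega
      have e1 : ((G - ε • 1 : End F V) ^ (j - 2 * i)) z = 0 := by
        rw [hpos, pow_succ, End.mul_apply, hNz, map_zero]
      rw [hxr', ← cap ((c.N_comm_G' ε).pow_pow i (j - 2 * i)), ← End.mul_apply ((G - ε • 1) ^ _) ((G - ε • 1) ^ _),
        ← pow_add, Nat.sub_add_cancel (by omega), hNf, hvz] at e1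
      have hev : (G + G').HasEigenvector (2 * ε) z := by
        rw [Module.End.hasEigenvector_iff, Module.End.mem_eigenspace_iff]
        refine ⟨?_, hz0⟩
        simp [gz, g'z, two_mul, add_smul]
      rw [Module.End.aeval_apply_of_hasEigenvector hev] at e1
      have := c.G'_pow_inj i e1
      rcases smul_eq_zero.1 this with h | h
      · exact hnd (dvd_iff_isRoot.2 h)
      · exact hz0 h
  obtain ⟨w, hw, hzw⟩ := c.sep hzS
  have hw' : ((G - ε • 1) ^ (j + 1)) w = 0 := by
    apply c.ker_N' hε
    apply c.nd
    intro y
    rw [c.symm, ← adj_pow (c.N_adj ε)]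
    exact hw _ (Submodule.mem_sup_right ⟨y, rfl⟩)
  have hP := pairEW c h2 (v := v) (w := w)
    (fun f => hw _ (Submodule.mem_sup_left (mem_E.2 ⟨f, rfl⟩)))
  refine ⟨_, _, hP, ?_, ?_⟩
  · refine chain c hv hw' ?_ (Submodule.mem_sup_left (Submodule.mem_sup_left (self_mem_E _ _)))
      (Submodule.mem_sup_right (Submodule.mem_sup_right (self_mem_E _ _)))
      (fun x hx => (hP.stable h2 hx).2) (Q_le c ε v w)
    have sk : ∀ u, ((G - ε • 1) ^ (j + 1)) u = 0 → B (((G - ε • 1) ^ j) u) u = 0 := by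
      intro u hu
      have := c.N_form hε j u hu
      rw [hj.neg_one_pow, c.symm u] at this
      have h3 : 2 * B (((G - ε • 1) ^ j) u) u = 0 := by linear_combination this
      simpa [h2] using h3
    intro α β h1 h3
    have e1 : B (((G - ε • 1) ^ j) w) v = - B z w := by
      rw [c.N_form hε j w hv, hj.neg_one_pow, c.symm, hvz]; ring
    rw [map_add, map_smul, map_smul, LinearMap.add_apply, LinearMap.smul_apply,
      LinearMap.smul_apply, sk v hv, e1] at h1
    rw [map_add, map_smul, map_smul, LinearMap.add_apply, LinearMap.smul_apply,
      LinearMap.smul_apply, sk w hw', hvz] at h3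
    simp [hzw] at h1 h3
    simp [h1, h3]
  · intro hb
    have : v ∈ (⊥ : Submodule F V) := hb ▸
      (Submodule.mem_sup_left (Submodule.mem_sup_left (self_mem_E _ _)))
    rw [Submodule.mem_bot] at this
    apply hz0; rw [← hvz, this, map_zero]

end p4
end S16

namespace S16
open Polynomial Module
section p5
variable {F : Type*} [Field F] {V : Type*} [AddCommGroup V] [Module F V]
variable {B : LinearMap.BilinForm F V} {G G' : End F V}

theorem findK [FiniteDimensional F V] (T : End F V) {x : V} (hx : x ≠ 0) (hTx : T x = 0) :
    ∃ j z, z ≠ 0 ∧ T z = 0 ∧ z ∈ LinearMap.range (T ^ j) ∧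
      ∀ x, T x = 0 → x ∈ LinearMap.range (T ^ (j + 1)) → x = 0 := by
  classical
  have hex : ∃ j, ∀ x, T x = 0 → x ∈ LinearMap.range (T ^ j) → x = 0 := by
    refine ⟨finrank F V, ?_⟩
    rintro _ h ⟨y, rfl⟩
    have h1 : y ∈ LinearMap.ker (T ^ (finrank F V + 1)) := by
      rw [LinearMap.mem_ker, pow_succ']; exact h
    rw [Module.End.ker_pow_eq_ker_pow_finrank_of_le (by omega)] at h1
    exact h1
  have hf := Nat.find_spec hex
  have hm := fun m => Nat.find_min hex (m := m)
  obtain ⟨k, hk⟩ : ∃ k, Nat.find hex = k := ⟨_, rfl⟩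
  rw [hk] at hf hm
  cases k with
  | zero => exact absurd (hf x hTx ⟨x, by simp⟩) hx
  | succ j =>
    have := hm j (by omega)
    push Not at this
    obtain ⟨z, h1, h3, h4⟩ := this
    exact ⟨j, z, h4, h1, h3, hf⟩

theorem case_inj [FiniteDimensional F V] [Nontrivial V] (c : Ctx B G G') (h2 : (2 : F) ≠ 0)
    (ha : ∀ x, (G - G') x = 0 → x = 0) :
    ∃ P M, Pair B G G' P M ∧ ND B (P ⊔ M) ∧ P ⊔ M ≠ ⊥ := by
  set s := G + G' with hs
  have hint : IsIntegral F s := Algebra.IsIntegral.isIntegral s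
  obtain ⟨r, hr, m, hm⟩ := WfDvdMonoid.exists_irreducible_factor (minpoly.not_isUnit F s)
    (minpoly.ne_zero hint)
  set T := aeval s r with hT
  have hms : aeval s m ≠ 0 := by
    intro h0
    have hd := minpoly.dvd F s h0
    have hm0 : m ≠ 0 := by
      rintro rfl; exact minpoly.ne_zero hint (by rw [hm, mul_zero])
    rw [hm] at hd
    obtain ⟨k, hk⟩ := hd
    apply hr.not_isUnit
    refine IsUnit.of_mul_eq_one k ?_
    apply mul_left_cancel₀ hm0
    linear_combination -hk
  obtain ⟨x, hx⟩ : ∃ x, aeval s m x ≠ 0 := by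
    by_contra! h; exact hms (LinearMap.ext h)
  have hTx : T (aeval s m x) = 0 := by
    rw [hT, ← End.mul_apply, ← map_mul, ← hm, minpoly.aeval]; rfl
  obtain ⟨j, z, hz0, hTz, ⟨v0, hv0⟩, hd⟩ := findK T hx hTx
  have hz2 : z ∉ LinearMap.range (T ^ (j + 1)) := fun h => hz0 (hd z hTz h)
  obtain ⟨w, hw, hzw⟩ := c.sep hz2
  have Tadj : ∀ x y, B (T x) y = B x (T y) := c.f_adj r
  have hw' : (T ^ (j + 1)) w = 0 := by
    apply c.nd
    intro y
    rw [c.symm, ← adj_pow Tadj]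
    exact hw _ ⟨y, rfl⟩
  have hv0' : (T ^ (j + 1)) v0 = 0 := by rw [pow_succ', End.mul_apply, hv0, hTz]
  obtain ⟨v, hv, hvv⟩ := polar (S := LinearMap.ker (T ^ (j + 1))) (T := T ^ j) (B := B) h2
    (fun x _ y _ => by rw [adj_pow Tadj, c.symm]) hv0' hw' (by rw [hv0]; exact hzw)
  have hv : (T ^ (j + 1)) v = 0 := hv
  have hP := pairEW c h2 (v := v) (w := 0) (by simp)
  simp only [E_zero, Submodule.map_bot, sup_bot_eq] at hP
  have core : ∀ f : F[X], (∀ e : F[X], B (aeval s f v) (aeval s e v) = 0) → aeval s f v = 0 := by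
    intro f hf
    have hcl : ∀ i, i ≤ j + 1 → ∃ f1 : F[X], aeval s f v = aeval s (r ^ i * f1) v := by
      intro i
      induction i with
      | zero => intro _; exact ⟨f, by simp⟩
      | succ i ih =>
        intro hi
        obtain ⟨f1, hf1⟩ := ih (by omega)
        by_cases hdv : r ∣ f1
        · obtain ⟨q, rfl⟩ := hdv
          exact ⟨q, by rw [hf1, pow_succ, mul_assoc]⟩
        · exfalso
          obtain ⟨u, u', huu⟩ := (hr.coprime_iff_not_dvd.2 hdv : IsCoprime r f1)
          apply hvv
          have e1 : (T ^ j) v = aeval s (u' * r ^ (j - i) * (r ^ i * f1)) v := by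
            have e2 : u' * r ^ (j - i) * (r ^ i * f1) = r ^ j - u * r ^ (j + 1) := by
              have : r ^ j = r ^ (j - i) * r ^ i := by rw [← pow_add]; congr 1; omega
              rw [pow_succ, this]
              linear_combination (r ^ (j - i) * r ^ i) * huu
            rw [e2, map_sub, map_mul, map_pow, map_pow, LinearMap.sub_apply, End.mul_apply, ← hT, hv]
            simp
          rw [e1, map_mul, End.mul_apply, ← hf1, c.f_adj]
          exact hf _
    obtain ⟨f1, hf1⟩ := hcl (j + 1) le_rfl
    rw [hf1, mul_comm, map_mul, End.mul_apply, map_pow, ← hT, hv, map_zero]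
  refine ⟨_, _, hP, ?_, ?_⟩
  · intro x hx hxQ
    obtain ⟨p, hp, m, hm, rfl⟩ := Submodule.mem_sup.1 hx
    obtain ⟨m, hm, rfl⟩ := hm
    obtain ⟨f, rfl⟩ := mem_E.1 hp
    obtain ⟨h, rfl⟩ := mem_E.1 hm
    have e1 : aeval s f v = 0 := by
      apply core
      intro e
      have := hxQ (aeval s e v) (Submodule.mem_sup_left (mem_E.2 ⟨e, rfl⟩))
      rwa [map_add, LinearMap.add_apply, c.symm ((G - G') _), c.faf h2, add_zero] at this
    have e2 : aeval s ((X ^ 2 - 4) * h) v = 0 := by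
      apply core
      intro e
      have := hxQ ((G - G') (aeval s e v))
        (Submodule.mem_sup_right (Submodule.mem_map_of_mem (mem_E.2 ⟨e, rfl⟩)))
      rw [e1, zero_add] at this
      rw [map_mul, End.mul_apply, ← c.aa, c.a_adj, this, neg_zero]
    rw [map_mul, End.mul_apply, ← c.aa] at e2
    rw [e1, ha _ e2, add_zero]
  · intro hb
    have : v ∈ (⊥ : Submodule F V) := hb ▸ (Submodule.mem_sup_left (self_mem_E _ _))
    rw [Submodule.mem_bot] at this
    apply hvv; simp [this]

theorem step [FiniteDimensional F V] [Nontrivial V] (c : Ctx B G G') (h2 : (2 : F) ≠ 0) :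
    ∃ P M, Pair B G G' P M ∧ ND B (P ⊔ M) ∧ P ⊔ M ≠ ⊥ := by
  by_cases hI : ∃ ε : F, ε * ε = 1 ∧ ∃ x : V, x ≠ 0 ∧ (G - ε • 1 : End F V) x = 0
  · obtain ⟨ε, hε, x, hx, hNx⟩ := hI
    obtain ⟨j, z, hz0, hTz, hz1, hd⟩ := findK _ hx hNx
    rcases Nat.even_or_odd j with hj | hj
    · obtain ⟨v, hv, hvv⟩ := find_odd c h2 hε hj hTz hz1 (fun h => hz0 (hd z hTz h))
      obtain ⟨hP, hN⟩ := odd_ND c h2 hv hvv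
      refine ⟨_, _, hP, hN, ?_⟩
      intro hb
      have : v ∈ (⊥ : Submodule F V) := hb ▸ (Submodule.mem_sup_left (self_mem_E _ _))
      rw [Submodule.mem_bot] at this
      apply hvv; simp [this]
    · exact even_case c h2 hε hj hz0 hTz hz1 hd
  · push Not at hI
    apply case_inj c h2
    intro x hx
    by_contra hx0
    have h1 := hI 1 (by ring) x hx0
    have e1 : G x = G' x := by simpa [sub_eq_zero] using hx
    have e2 : G (G x) = x := by rw [e1, c.gg']
    apply hI (-1) (by ring) _ h1
    simp [e2]

/-- A nondegenerate invariant subspace has an orthogonal complement that supports a pair. -/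
theorem compl_ctx [FiniteDimensional F V] (c : Ctx B G G') {Q : Submodule F V} (hQ : ND B Q)
    (hG : ∀ x ∈ Q, G x ∈ Q) (hG' : ∀ x ∈ Q, G' x ∈ Q) :
    ∃ (U : Submodule F V) (hU : ∀ x ∈ U, G x ∈ U) (hU' : ∀ x ∈ U, G' x ∈ U),
      IsCompl Q U ∧ (∀ x ∈ Q, ∀ y ∈ U, B x y = 0) ∧
      Ctx (B.restrict U) (G.restrict hU) (G'.restrict hU') := by
  have hmem : ∀ y, y ∈ B.orthogonal Q ↔ ∀ x ∈ Q, B x y = 0 := fun y => Iff.rfl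
  have hrefl : B.IsRefl := fun x y h => by rw [c.symm]; exact h
  have hcompl : IsCompl Q (B.orthogonal Q) := by
    rw [LinearMap.BilinForm.isCompl_orthogonal_iff_disjoint hrefl, Submodule.disjoint_def]
    intro x hx hx'
    exact hQ x hx (fun y hy => by rw [c.symm]; exact hx' y hy)
  refine ⟨B.orthogonal Q, ?_, ?_, hcompl, fun x hx y hy => hy x hx, ?_⟩
  · intro x hx y hy
    change B y (G x) = 0
    rw [← c.adj']; exact hx _ (hG' y hy)
  · intro x hx y hy
    change B y (G' x) = 0
    rw [← c.adj]; exact hx _ (hG y hy)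
  · refine ⟨fun x y => c.symm x y, ?_, fun x => ?_, fun x => ?_, fun x y => c.adj x y⟩
    · rintro ⟨x, hx⟩ h
      apply Subtype.ext
      apply c.nd
      intro y
      have hy : y ∈ Q ⊔ B.orthogonal Q := hcompl.sup_eq_top ▸ trivial
      obtain ⟨a, ha, b, hb, rfl⟩ := Submodule.mem_sup.1 hy
      have h1 : B x b = 0 := h ⟨b, hb⟩
      have h3 : B a x = 0 := hx a ha
      rw [map_add, h1, c.symm, h3, add_zero]
    · apply Subtype.ext; exact c.gg' x
    · apply Subtype.ext; exact c.g'g x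

theorem lift_pair {U : Submodule F V} (hU : ∀ x ∈ U, G x ∈ U) (hU' : ∀ x ∈ U, G' x ∈ U)
    {P M : Submodule F U} (h : Pair (B.restrict U) (G.restrict hU) (G'.restrict hU') P M) :
    Pair B G G' (P.map U.subtype) (M.map U.subtype) := by
  refine ⟨?_, ?_, ?_, ?_, ?_⟩
  · rintro _ ⟨x, hx, rfl⟩ _ ⟨y, hy, rfl⟩
    exact h.orth x hx y hy
  · rintro _ ⟨x, hx, rfl⟩; exact ⟨_, h.sP x hx, rfl⟩
  · rintro _ ⟨x, hx, rfl⟩; exact ⟨_, h.sM x hx, rfl⟩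
  · rintro _ ⟨x, hx, rfl⟩; exact ⟨_, h.aP x hx, rfl⟩
  · rintro _ ⟨x, hx, rfl⟩; exact ⟨_, h.aM x hx, rfl⟩

end p5

universe u v
theorem exists_pair {F : Type u} [Field F] (h2 : (2 : F) ≠ 0) (n : ℕ) :
    ∀ (V : Type v) [AddCommGroup V] [Module F V] [FiniteDimensional F V]
    (B : LinearMap.BilinForm F V) (G G' : End F V), Ctx B G G' → finrank F V = n →
    ∃ P M, Pair B G G' P M ∧ P ⊔ M = ⊤ := by
  induction n using Nat.strong_induction_on with
  | _ n ih =>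
  intro V _ _ _ B G G' c hn
  rcases subsingleton_or_nontrivial V with hV | hV
  · refine ⟨⊥, ⊥, ⟨?_, ?_, ?_, ?_, ?_⟩, Subsingleton.elim _ _⟩
    all_goals simp
  · obtain ⟨P, M, hP, hN, hb⟩ := step c h2
    obtain ⟨U, hU, hU', hc, ho, cU⟩ := compl_ctx c hN (fun x hx => (hP.stable h2 hx).1)
      (fun x hx => (hP.stable h2 hx).2)
    have hlt : finrank F U < n := by
      have h1 := Submodule.finrank_add_eq_of_isCompl hc
      have h3 : 0 < finrank F (P ⊔ M : Submodule F V) := by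
        rw [Nat.pos_iff_ne_zero, Ne, Submodule.finrank_eq_zero]; exact hb
      omega
    obtain ⟨P', M', hP', hT⟩ := ih _ hlt U _ _ _ cU rfl
    have hL := lift_pair hU hU' hP'
    have hs : P'.map U.subtype ⊔ M'.map U.subtype = U := by
      rw [← Submodule.map_sup, hT]; simp
    refine ⟨P ⊔ P'.map U.subtype, M ⊔ M'.map U.subtype, hP.sup hL ?_ ?_, ?_⟩
    · intro x hx y hy
      exact ho x (Submodule.mem_sup_left hx) y (hs ▸ Submodule.mem_sup_right hy)
    · intro x hx y hy
      rw [c.symm]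
      exact ho y (Submodule.mem_sup_right hy) x (hs ▸ Submodule.mem_sup_left hx)
    · rw [sup_sup_sup_comm, hs, hc.sup_eq_top]

theorem main_lin {F : Type u} [Field F] (h2 : (2 : F) ≠ 0) {V : Type v} [AddCommGroup V]
    [Module F V] [FiniteDimensional F V]
    {B : LinearMap.BilinForm F V} {G G' : End F V} (c : Ctx B G G') {ε : F} (hε : ε * ε = 1)
    {j : ℕ} (hj : Even j)
    (hr : finrank F (LinearMap.range ((G - ε • 1 : End F V) ^ j)) +
      finrank F (LinearMap.range ((G - ε • 1 : End F V) ^ (j + 2))) ≠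
      2 * finrank F (LinearMap.range ((G - ε • 1 : End F V) ^ (j + 1)))) :
    ∃ t t' : End F V, (t * t = 1 ∧ (∀ x y, B (t x) (t y) = B x y) ∧ t * G * t = G' ∧
        LinearMap.det t = 1) ∧
      (t' * t' = 1 ∧ (∀ x y, B (t' x) (t' y) = B x y) ∧ t' * G * t' = G' ∧
        LinearMap.det t' = -1) := by
  obtain ⟨z, hz, hz1, hz2⟩ : ∃ z, (G - ε • 1 : End F V) z = 0 ∧
      z ∈ LinearMap.range ((G - ε • 1 : End F V) ^ j) ∧
      z ∉ LinearMap.range ((G - ε • 1 : End F V) ^ (j + 1)) := by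
    by_contra! hcon
    apply hr
    generalize (G - ε • 1 : End F V) = N at hcon ⊢
    have hm : ∀ i, (LinearMap.range (N ^ i)).map N = LinearMap.range (N ^ (i + 1)) := by
      intro i; rw [pow_succ', Module.End.mul_eq_comp, LinearMap.range_comp]
    have e1 := finrank_map_ker N (LinearMap.range (N ^ j))
    have e2 := finrank_map_ker N (LinearMap.range (N ^ (j + 1)))
    have e3 : LinearMap.range (N ^ j) ⊓ LinearMap.ker N =
        LinearMap.range (N ^ (j + 1)) ⊓ LinearMap.ker N := by
      apply le_antisymm
      · rintro x ⟨hx, hx'⟩; exact ⟨hcon x hx' hx, hx'⟩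
      · rintro x ⟨⟨y, rfl⟩, hx'⟩
        exact ⟨⟨N y, by rw [← End.mul_apply, ← pow_succ]⟩, hx'⟩
    rw [hm, e3] at e1
    rw [hm] at e2
    have e4 : j + 1 + 1 = j + 2 := rfl
    rw [e4] at e2
    omega
  obtain ⟨v, hv, hvv⟩ := find_odd c h2 hε hj hz hz1 hz2
  obtain ⟨hP, hN⟩ := odd_ND c h2 hv hvv
  have hfr := odd_finrank c h2 hε hj hv hvv
  generalize (E (G + G') v) = P at hP hN hfr
  generalize P.map (G - G') = M at hP hN hfr
  obtain ⟨U, hU, hU', hc, ho, cU⟩ := compl_ctx c hN (fun x hx => (hP.stable h2 hx).1)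
    (fun x hx => (hP.stable h2 hx).2)
  obtain ⟨P', M', hP', hT⟩ := exists_pair h2 _ U _ _ _ cU rfl
  have hL := lift_pair hU hU' hP'
  have hs : P'.map U.subtype ⊔ M'.map U.subtype = U := by
    rw [← Submodule.map_sup, hT]; simp
  generalize P'.map U.subtype = P1 at hL hs
  generalize M'.map U.subtype = M1 at hL hs
  have hM1 : M1 ≤ U := hs ▸ le_sup_right
  have hP1 : P1 ≤ U := hs ▸ le_sup_left
  have oP : ∀ x ∈ P, ∀ y ∈ U, B x y = 0 := fun x hx => ho x (Submodule.mem_sup_left hx)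
  have oM : ∀ x ∈ M, ∀ y ∈ U, B x y = 0 := fun x hx => ho x (Submodule.mem_sup_right hx)
  have hA := hP.sup hL (fun x hx y hy => oP x hx y (hM1 hy))
    (fun x hx y hy => by rw [c.symm]; exact oM y hy x (hP1 hx))
  have hB := (hP.swap c).sup hL (fun x hx y hy => oM x hx y (hM1 hy))
    (fun x hx y hy => by rw [c.symm]; exact oP y hy x (hP1 hx))
  obtain ⟨t, t1, t2, t3, t4⟩ := hA.invol c h2 (by rw [sup_sup_sup_comm, hs, hc.sup_eq_top])
  obtain ⟨t', t1', t2', t3', t4'⟩ := hB.invol c h2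
    (by rw [sup_sup_sup_comm, hs, sup_comm M, hc.sup_eq_top])
  have f1 : finrank F (M ⊔ M1 : Submodule F V) = finrank F M + finrank F M1 := by
    have := Submodule.finrank_sup_add_finrank_inf_eq M M1
    rw [(hc.disjoint.mono le_sup_right hM1).eq_bot, finrank_bot] at this
    exact this
  have f2 : finrank F (P ⊔ M1 : Submodule F V) = finrank F M + finrank F M1 + 1 := by
    have := Submodule.finrank_sup_add_finrank_inf_eq P M1
    rw [(hc.disjoint.mono le_sup_left hM1).eq_bot, finrank_bot] at this
    omega
  rw [f1] at t4
  rw [f2, pow_succ, ← t4] at t4'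
  rcases neg_one_pow_eq_or F (finrank F M + finrank F M1) with h | h
  · rw [h] at t4; rw [t4] at t4'
    exact ⟨t, t', ⟨t1, t2, t3, t4⟩, ⟨t1', t2', t3', by simpa using t4'⟩⟩
  · rw [h] at t4; rw [t4] at t4'
    exact ⟨t', t, ⟨t1', t2', t3', by simpa using t4'⟩, ⟨t1, t2, t3, t4⟩⟩

end S16

namespace S16
open Polynomial Module
section p6

theorem toGL {F : Type*} [Field F] {n : ℕ} (η : Matrix (Fin n) (Fin n) F)
    (g : Matrix.GeneralLinearGroup (Fin n) F) (t : End F (Fin n → F)) (d : F)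
    (h1 : t * t = 1)
    (h2 : ∀ x y, Matrix.toBilin' η (t x) (t y) = Matrix.toBilin' η x y)
    (h3 : t * Matrix.toLin' (g : Matrix (Fin n) (Fin n) F) * t =
      Matrix.toLin' ((g⁻¹ : Matrix.GeneralLinearGroup (Fin n) F) : Matrix (Fin n) (Fin n) F))
    (h4 : LinearMap.det t = d) :
    ∃ h : Matrix.GeneralLinearGroup (Fin n) F,
      (↑h : Matrix (Fin n) (Fin n) F).transpose * η * (↑h : Matrix (Fin n) (Fin n) F) = η ∧
      h * h = 1 ∧ h * g * h⁻¹ = g⁻¹ ∧ Matrix.det (↑h : Matrix (Fin n) (Fin n) F) = d := by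
  have m1 : LinearMap.toMatrix' t * LinearMap.toMatrix' t = 1 := by
    rw [← LinearMap.toMatrix'_mul, h1, LinearMap.toMatrix'_one]
  refine ⟨⟨LinearMap.toMatrix' t, LinearMap.toMatrix' t, m1, m1⟩, ?_, Units.ext m1, ?_, ?_⟩
  · apply Matrix.toBilin'.injective
    have : Matrix.toBilin' η = (Matrix.toBilin' η).comp t t := by
      ext x y; simp [h2]
    conv_rhs => rw [this]
    have h5 := Matrix.toBilin'_comp η (LinearMap.toMatrix' t) (LinearMap.toMatrix' t)
    rw [Matrix.toLin'_toMatrix'] at h5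
    exact h5.symm
  · apply Units.ext
    apply Matrix.toLin'.injective
    rw [← h3]
    change Matrix.toLin' (LinearMap.toMatrix' t * (g : Matrix (Fin n) (Fin n) F) *
      LinearMap.toMatrix' t) = _
    rw [Matrix.toLin'_mul, Matrix.toLin'_mul, Matrix.toLin'_toMatrix']; rfl
  · change Matrix.det (LinearMap.toMatrix' t) = d
    rw [LinearMap.det_toMatrix', h4]

end p6
end S16

/-- If `g` in a finite orthogonal group (odd `q`) has an elementary divisor
`(t ∓ 1)^k` with `k` odd, then `g` is inverted by involutions in the orthogonal
group of determinant `1` and of determinant `−1`; in particular `g` is strongly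
real in the special orthogonal group. -/
theorem stmt_16 (p e q n : ℕ) (hp : p.Prime) (he : 0 < e) (hq : q = p ^ e)
    (hodd : Odd q) (F : Type*) [Field F] [Fintype F] (hcard : Fintype.card F = q)
    (η : Matrix (Fin n) (Fin n) F) (hsym : η.transpose = η) (hηdet : IsUnit η.det)
    (g : Matrix.GeneralLinearGroup (Fin n) F)
    (hg : (↑g : Matrix (Fin n) (Fin n) F).transpose * η *
      (↑g : Matrix (Fin n) (Fin n) F) = η)
    (hoddED : ∃ ε : F, (ε = 1 ∨ ε = -1) ∧ ∃ k : ℕ, Odd k ∧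
      (((↑g : Matrix (Fin n) (Fin n) F) - ε • 1) ^ (k - 1)).rank +
          (((↑g : Matrix (Fin n) (Fin n) F) - ε • 1) ^ (k + 1)).rank ≠
        2 * (((↑g : Matrix (Fin n) (Fin n) F) - ε • 1) ^ k).rank) :
    ∃ h h' : Matrix.GeneralLinearGroup (Fin n) F,
      (↑h : Matrix (Fin n) (Fin n) F).transpose * η *
        (↑h : Matrix (Fin n) (Fin n) F) = η ∧
      (↑h' : Matrix (Fin n) (Fin n) F).transpose * η *
        (↑h' : Matrix (Fin n) (Fin n) F) = η ∧
      h * h = 1 ∧ h' * h' = 1 ∧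
      h * g * h⁻¹ = g⁻¹ ∧ h' * g * h'⁻¹ = g⁻¹ ∧
      Matrix.det (↑h : Matrix (Fin n) (Fin n) F) = 1 ∧
      Matrix.det (↑h' : Matrix (Fin n) (Fin n) F) = -1 := by
  have h2 : (2 : F) ≠ 0 := by
    apply Ring.two_ne_zero
    intro hc
    have := FiniteField.even_card_of_char_two hc
    rw [hcard] at this
    obtain ⟨m, hm⟩ := hodd
    omega
  have gg : (g : Matrix (Fin n) (Fin n) F) *
      ((g⁻¹ : Matrix.GeneralLinearGroup (Fin n) F) : Matrix (Fin n) (Fin n) F) = 1 := g.mul_inv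
  have gg' : ((g⁻¹ : Matrix.GeneralLinearGroup (Fin n) F) : Matrix (Fin n) (Fin n) F) *
      (g : Matrix (Fin n) (Fin n) F) = 1 := g.inv_mul
  have c : S16.Ctx (Matrix.toBilin' η) (Matrix.toLin' (g : Matrix (Fin n) (Fin n) F))
      (Matrix.toLin' ((g⁻¹ : Matrix.GeneralLinearGroup (Fin n) F) : Matrix (Fin n) (Fin n) F)) := by
    refine ⟨?_, ?_, ?_, ?_, ?_⟩
    · intro x y
      rw [Matrix.toBilin'_apply', Matrix.toBilin'_apply', Matrix.dotProduct_mulVec,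
        ← Matrix.mulVec_transpose, hsym, dotProduct_comm]
    · intro x hx
      have hz : Matrix.vecMul x η = 0 := by
        ext i
        have := hx (Pi.single i 1)
        rw [Matrix.toBilin'_apply', Matrix.dotProduct_mulVec] at this
        simpa using this
      have : Matrix.vecMul (Matrix.vecMul x η) η⁻¹ = x := by
        rw [Matrix.vecMul_vecMul, Matrix.mul_nonsing_inv _ hηdet, Matrix.vecMul_one]
      rw [← this, hz, Matrix.zero_vecMul]
    · intro x
      rw [Matrix.toLin'_apply, Matrix.toLin'_apply, Matrix.mulVec_mulVec, gg, Matrix.one_mulVec]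
    · intro x
      rw [Matrix.toLin'_apply, Matrix.toLin'_apply, Matrix.mulVec_mulVec, gg', Matrix.one_mulVec]
    · intro x y
      rw [Matrix.toBilin'_apply', Matrix.toBilin'_apply', Matrix.toLin'_apply, Matrix.toLin'_apply]
      have : η * ((g⁻¹ : Matrix.GeneralLinearGroup (Fin n) F) : Matrix (Fin n) (Fin n) F) =
          (g : Matrix (Fin n) (Fin n) F).transpose * η := by
        conv_lhs => rw [← hg]
        rw [mul_assoc, gg, mul_one]
      rw [Matrix.mulVec_mulVec, this, ← Matrix.mulVec_mulVec, Matrix.dotProduct_mulVec x,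
        Matrix.vecMul_transpose]
  obtain ⟨ε, hε, k, ⟨m, rfl⟩, hr⟩ := hoddED
  have hε' : ε * ε = 1 := by rcases hε with rfl | rfl <;> simp
  have hrk : ∀ i, (((↑g : Matrix (Fin n) (Fin n) F) - ε • 1) ^ i).rank =
      Module.finrank F (LinearMap.range ((Matrix.toLin' (g : Matrix (Fin n) (Fin n) F) -
        ε • (1 : Module.End F (Fin n → F))) ^ i)) := by
    intro i
    have : Matrix.toLin' (g : Matrix (Fin n) (Fin n) F) - ε • (1 : Module.End F (Fin n → F)) =
        Matrix.toLin' ((g : Matrix (Fin n) (Fin n) F) - ε • 1) := by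
      rw [map_sub, map_smul, Matrix.toLin'_one]; rfl
    rw [this, ← Matrix.toLin'_pow]; rfl
  simp only [hrk] at hr
  obtain ⟨t, t', ⟨a1, a2, a3, a4⟩, b1, b2, b3, b4⟩ :=
    S16.main_lin (j := 2 * m) h2 c hε' (even_two_mul m) hr
  obtain ⟨h, x1, x2, x3, x4⟩ := S16.toGL η g t _ a1 a2 a3 a4
  obtain ⟨h', y1, y2, y3, y4⟩ := S16.toGL η g t' _ b1 b2 b3 b4
  exact ⟨h, h', x1, y1, x2, y2, x3, y3, x4, y4⟩
end
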